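/- Let G = F_2^n and let X_1^0, X_2^0 be finitely supported G-valued random variables. Then there exists a subgroup H ≤ G such that d[X_1^0; U_H] + d[X_2^0; U_H] ≤ 11 · d[X_1^0; X_2^0], where U_H denotes a uniformly distributed random variable on H. Furthermore, both d[X_1^0; U_H] and d[X_2^0; U_H] are at most 6 · d[X_1^0; X_2^0]. -/

import Mathlib

open scoped Classical BigOperators Pointwise
open Finset

noncomputable section

/-- The probability that the random variable `X` equals `s`, under the pmf `μ`. -/
def pmass {Ω S : Type*} [Fintype Ω] (μ : Ω → ℝ) (X : Ω → S) (s : S) : ℝ :=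
  ∑ ω, if X ω = s then μ ω else 0

/-- `μ` is a probability mass function on the finite type `Ω`. -/
def IsProb {Ω : Type*} [Fintype Ω] (μ : Ω → ℝ) : Prop :=
  (∀ ω, 0 ≤ μ ω) ∧ ∑ ω, μ ω = 1

/-- Shannon entropy `H[X]` of a random variable `X : Ω → S` under `μ`. -/
def ent {Ω S : Type*} [Fintype Ω] (μ : Ω → ℝ) (X : Ω → S) : ℝ :=
  ∑ s ∈ Finset.univ.image X, Real.negMulLog (pmass μ X s)

/-- Mutual information `I[X : Y]`. -/
def mutualInfo {Ω S T : Type*} [Fintype Ω] (μ : Ω → ℝ) (X : Ω → S) (Y : Ω → T) : ℝ :=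
  ent μ X + ent μ Y - ent μ (fun ω => (X ω, Y ω))

/-- The conditional measure, conditioning on the event `Y = y`. -/
def condMeas {Ω T : Type*} [Fintype Ω] (μ : Ω → ℝ) (Y : Ω → T) (y : T) : Ω → ℝ :=
  fun ω => if Y ω = y then μ ω / pmass μ Y y else 0

/-- Conditional mutual information `I[X : Y | Z]`. -/
def condMutualInfo {Ω S T U : Type*} [Fintype Ω] (μ : Ω → ℝ)
    (X : Ω → S) (Y : Ω → T) (Z : Ω → U) : ℝ :=
  ∑ z ∈ Finset.univ.image Z, pmass μ Z z * mutualInfo (condMeas μ Z z) X Y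

/-- Entropic Ruzsa distance `d[X ; Y]`, defined via independent copies on a product space. -/
def rdist {Ω₁ Ω₂ G : Type*} [Fintype Ω₁] [Fintype Ω₂] [AddCommGroup G]
    (μ₁ : Ω₁ → ℝ) (X : Ω₁ → G) (μ₂ : Ω₂ → ℝ) (Y : Ω₂ → G) : ℝ :=
  ent (fun p : Ω₁ × Ω₂ => μ₁ p.1 * μ₂ p.2) (fun p => X p.1 - Y p.2)
    - ent μ₁ X / 2 - ent μ₂ Y / 2

/-- Conditional Ruzsa distance `d[X | Z ; Y | W]`. -/
def condRdist {Ω₁ Ω₂ G T U : Type*} [Fintype Ω₁] [Fintype Ω₂] [AddCommGroup G]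
    (μ₁ : Ω₁ → ℝ) (X : Ω₁ → G) (Z : Ω₁ → T)
    (μ₂ : Ω₂ → ℝ) (Y : Ω₂ → G) (W : Ω₂ → U) : ℝ :=
  ∑ z ∈ Finset.univ.image Z, ∑ w ∈ Finset.univ.image W,
    pmass μ₁ Z z * pmass μ₂ W w * rdist (condMeas μ₁ Z z) X (condMeas μ₂ W w) Y

/-- Conditional Ruzsa distance `d[X ; Y | W]`, conditioning only on the right variable. -/
def condRdistRight {Ω₁ Ω₂ G U : Type*} [Fintype Ω₁] [Fintype Ω₂] [AddCommGroup G]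
    (μ₁ : Ω₁ → ℝ) (X : Ω₁ → G)
    (μ₂ : Ω₂ → ℝ) (Y : Ω₂ → G) (W : Ω₂ → U) : ℝ :=
  ∑ w ∈ Finset.univ.image W, pmass μ₂ W w * rdist μ₁ X (condMeas μ₂ W w) Y

/-- The uniform probability mass function on a subset `H` of a finite type. -/
def unifOn {G : Type*} [Fintype G] (H : Set G) : G → ℝ :=
  fun g => if g ∈ H then ((Nat.card H : ℝ))⁻¹ else 0

/-- `X` (under `μ₁`) and `Y` (under `μ₂`) are identically distributed. -/
def IdentDist {Ω₁ Ω₂ S : Type*} [Fintype Ω₁] [Fintype Ω₂]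
    (μ₁ : Ω₁ → ℝ) (X : Ω₁ → S) (μ₂ : Ω₂ → ℝ) (Y : Ω₂ → S) : Prop :=
  ∀ s, pmass μ₁ X s = pmass μ₂ Y s

/-- Two random variables are independent. -/
def IndepPair {Ω S T : Type*} [Fintype Ω] (μ : Ω → ℝ) (X : Ω → S) (Y : Ω → T) : Prop :=
  ∀ s t, pmass μ (fun ω => (X ω, Y ω)) (s, t) = pmass μ X s * pmass μ Y t

/-- Three random variables are jointly independent. -/
def IndepTriple {Ω S T U : Type*} [Fintype Ω] (μ : Ω → ℝ)
    (X : Ω → S) (Y : Ω → T) (Z : Ω → U) : Prop :=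
  ∀ s t u, pmass μ (fun ω => (X ω, Y ω, Z ω)) (s, t, u)
    = pmass μ X s * pmass μ Y t * pmass μ Z u

/-- Four random variables are jointly independent. -/
def IndepFour {Ω S T U V : Type*} [Fintype Ω] (μ : Ω → ℝ)
    (X : Ω → S) (Y : Ω → T) (Z : Ω → U) (W : Ω → V) : Prop :=
  ∀ s t u v, pmass μ (fun ω => (X ω, Y ω, Z ω, W ω)) (s, t, u, v)
    = pmass μ X s * pmass μ Y t * pmass μ Z u * pmass μ W v


set_option linter.unusedSectionVars false

section PFR

variable {Ω Ω' Ω'' Ω''' S T U V : Type} [Fintype Ω] [Fintype Ω'] [Fintype Ω''] [Fintype Ω''']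
  [Fintype S] [Fintype T] [Fintype U] [Fintype V]

/-- product measure -/
def pr (μ : Ω → ℝ) (ν : Ω' → ℝ) : Ω × Ω' → ℝ := fun p => μ p.1 * ν p.2

/-- pushforward relation -/
def Pushes (μ : Ω → ℝ) (φ : Ω → Ω') (μ' : Ω' → ℝ) : Prop :=
  ∀ F : Ω' → ℝ, ∑ ω, μ ω * F (φ ω) = ∑ ω', μ' ω' * F ω'

lemma pmass_eq (μ : Ω → ℝ) (X : Ω → S) (s : S) :
    pmass μ X s = ∑ ω, μ ω * (if X ω = s then 1 else 0) := by
  simp [pmass]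

lemma ent_eq_sum (μ : Ω → ℝ) (X : Ω → S) :
    ent μ X = ∑ s, Real.negMulLog (pmass μ X s) := by
  unfold ent
  apply Finset.sum_subset (Finset.subset_univ _)
  intro s _ hs
  have : pmass μ X s = 0 := by
    unfold pmass
    apply Finset.sum_eq_zero
    intro ω _
    rw [if_neg]
    rintro rfl
    exact hs (Finset.mem_image_of_mem _ (Finset.mem_univ _))
  simp [this]

lemma pushes_law (μ : Ω → ℝ) (X : Ω → S) : Pushes μ X (pmass μ X) := by
  intro F
  simp only [pmass, Finset.sum_mul]
  rw [Finset.sum_comm]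
  apply Finset.sum_congr rfl
  intro ω _
  simp [ite_mul]

lemma Pushes.pmass {μ : Ω → ℝ} {φ : Ω → Ω'} {μ' : Ω' → ℝ} (h : Pushes μ φ μ') (X : Ω' → S)
    (s : S) : pmass μ (fun ω => X (φ ω)) s = pmass μ' X s := by
  rw [pmass_eq, pmass_eq]
  exact h (fun ω' => if X ω' = s then 1 else 0)

lemma Pushes.ent {μ : Ω → ℝ} {φ : Ω → Ω'} {μ' : Ω' → ℝ} (h : Pushes μ φ μ') (X : Ω' → S) :
    ent μ (fun ω => X (φ ω)) = ent μ' X := by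
  rw [ent_eq_sum, ent_eq_sum]
  simp only [h.pmass X]

lemma Pushes.id (μ : Ω → ℝ) : Pushes μ (fun ω => ω) μ := fun _ => rfl

lemma Pushes.prod {μ : Ω → ℝ} {φ : Ω → Ω'} {μ' : Ω' → ℝ} (h : Pushes μ φ μ')
    {ν : Ω'' → ℝ} {ψ : Ω'' → Ω'''} {ν' : Ω''' → ℝ} (k : Pushes ν ψ ν') :
    Pushes (pr μ ν) (fun p => (φ p.1, ψ p.2)) (pr μ' ν') := by
  intro F
  simp only [pr, Fintype.sum_prod_type, mul_assoc]
  have h1 : ∀ ω, ∑ x, μ ω * (ν x * F (φ ω, ψ x)) = μ ω * ∑ x, ν' x * F (φ ω, x) := by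
    intro ω
    rw [← k (fun x => F (φ ω, x)), Finset.mul_sum]
  simp only [h1]
  rw [h (fun w => ∑ x, ν' x * F (w, x))]
  simp only [Finset.mul_sum]

lemma Pushes.fst (μ : Ω → ℝ) {ν : Ω' → ℝ} (hν : IsProb ν) : Pushes (pr μ ν) Prod.fst μ := by
  intro F
  simp only [pr, Fintype.sum_prod_type]
  apply Finset.sum_congr rfl
  intro ω _
  rw [← Finset.sum_mul, ← Finset.mul_sum, hν.2, mul_one]

lemma Pushes.snd {μ : Ω → ℝ} (ν : Ω' → ℝ) (hμ : IsProb μ) : Pushes (pr μ ν) Prod.snd ν := by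
  intro F
  simp only [pr, Fintype.sum_prod_type]
  rw [Finset.sum_comm]
  apply Finset.sum_congr rfl
  intro ω _
  rw [← Finset.sum_mul, ← Finset.sum_mul, hμ.2, one_mul]

lemma Pushes.of_equiv {μ : Ω → ℝ} {μ' : Ω' → ℝ} (e : Ω ≃ Ω') (h : ∀ ω, μ' (e ω) = μ ω) :
    Pushes μ e μ' := by
  intro F
  rw [← Equiv.sum_comp e]
  simp only [h]

lemma Pushes.of_inv {μ : Ω → ℝ} {μ' : Ω' → ℝ} (f : Ω → Ω') (g : Ω' → Ω)
    (h1 : ∀ x, g (f x) = x) (h2 : ∀ x, f (g x) = x) (h : ∀ ω, μ' (f ω) = μ ω) :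
    Pushes μ f μ' := Pushes.of_equiv ⟨f, g, h1, h2⟩ h

lemma IsProb.pr {μ : Ω → ℝ} {ν : Ω' → ℝ} (hμ : IsProb μ) (hν : IsProb ν) : IsProb (pr μ ν) := by
  refine ⟨fun p => mul_nonneg (hμ.1 _) (hν.1 _), ?_⟩
  simp only [_root_.pr, Fintype.sum_prod_type, ← Finset.mul_sum, hν.2, mul_one, hμ.2]

lemma pmass_nonneg {μ : Ω → ℝ} (hμ : IsProb μ) (X : Ω → S) (s : S) : 0 ≤ pmass μ X s := by
  unfold pmass
  apply Finset.sum_nonneg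
  intro ω _
  split_ifs
  · exact hμ.1 ω
  · exact le_rfl

lemma pmass_sum {μ : Ω → ℝ} (hμ : IsProb μ) (X : Ω → S) : ∑ s, pmass μ X s = 1 := by
  have := pushes_law μ X (fun _ => 1)
  simp only [mul_one] at this
  rw [← this, hμ.2]

lemma isProb_law {μ : Ω → ℝ} (hμ : IsProb μ) (X : Ω → S) : IsProb (pmass μ X) :=
  ⟨pmass_nonneg hμ X, pmass_sum hμ X⟩

lemma le_pmass {μ : Ω → ℝ} (hμ : IsProb μ) (X : Ω → S) (ω : Ω) : μ ω ≤ pmass μ X (X ω) := by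
  unfold pmass
  have := Finset.single_le_sum (f := fun ω' => if X ω' = X ω then μ ω' else 0)
    (fun ω' _ => by split_ifs; exacts [hμ.1 ω', le_rfl]) (Finset.mem_univ ω)
  simpa using this

lemma pmass_id (p : S → ℝ) : pmass p (fun g => g) = p := by
  funext s; simp [pmass]

lemma ent_eq_exp (μ : Ω → ℝ) (X : Ω → S) :
    ent μ X = ∑ ω, μ ω * (- Real.log (pmass μ X (X ω))) := by
  rw [ent_eq_sum, pushes_law μ X (fun s => - Real.log (pmass μ X s))]
  apply Finset.sum_congr rfl
  intro s _
  rw [Real.negMulLog]; ring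

lemma pmass_congr_ae {μ : Ω → ℝ} {X Y : Ω → S} (h : ∀ ω, μ ω ≠ 0 → X ω = Y ω) (s : S) :
    pmass μ X s = pmass μ Y s := by
  unfold pmass
  apply Finset.sum_congr rfl
  intro ω _
  by_cases h0 : μ ω = 0
  · simp [h0]
  · rw [h ω h0]

lemma ent_congr_ae {μ : Ω → ℝ} {X Y : Ω → S} (h : ∀ ω, μ ω ≠ 0 → X ω = Y ω) :
    ent μ X = ent μ Y := by
  rw [ent_eq_sum, ent_eq_sum]
  simp only [pmass_congr_ae h]

lemma pmass_le_comp {μ : Ω → ℝ} (hμ : IsProb μ) (X : Ω → S) (f : S → T) (s : S) :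
    pmass μ X s ≤ pmass μ (fun ω => f (X ω)) (f s) := by
  unfold pmass
  apply Finset.sum_le_sum
  intro ω _
  have := hμ.1 ω
  by_cases h : X ω = s
  · simp [h]
  · rw [if_neg h]; split_ifs <;> simp [this]

lemma ent_comp_le {μ : Ω → ℝ} (hμ : IsProb μ) (X : Ω → S) (f : S → T) :
    ent μ (fun ω => f (X ω)) ≤ ent μ X := by
  rw [ent_eq_exp, ent_eq_exp]
  apply Finset.sum_le_sum
  intro ω _
  rcases (hμ.1 ω).eq_or_lt with h | h
  · simp [← h]
  · apply mul_le_mul_of_nonneg_left _ h.le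
    apply neg_le_neg
    apply Real.log_le_log (h.trans_le (le_pmass hμ X ω))
    exact pmass_le_comp hμ X f (X ω)

lemma ent_eq_of {μ : Ω → ℝ} (hμ : IsProb μ) {X : Ω → S} {Y : Ω → T} (f : S → T) (g : T → S)
    (hf : ∀ ω, μ ω ≠ 0 → f (X ω) = Y ω) (hg : ∀ ω, μ ω ≠ 0 → g (Y ω) = X ω) :
    ent μ X = ent μ Y := by
  apply le_antisymm
  · rw [← ent_congr_ae hg]; exact ent_comp_le hμ Y g
  · rw [← ent_congr_ae hf]; exact ent_comp_le hμ X f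

lemma sum_pmass_fst (μ : Ω → ℝ) (X : Ω → S) (Z : Ω → T) (z : T) :
    ∑ x, pmass μ (fun ω => (X ω, Z ω)) (x, z) = pmass μ Z z := by
  unfold pmass
  rw [Finset.sum_comm]
  apply Finset.sum_congr rfl
  intro ω _
  by_cases h : Z ω = z <;> simp [h]

lemma ent_submod {μ : Ω → ℝ} (hμ : IsProb μ) (X : Ω → S) (Y : Ω → T) (Z : Ω → U) :
    ent μ (fun ω => (X ω, Y ω, Z ω)) + ent μ Z
      ≤ ent μ (fun ω => (X ω, Z ω)) + ent μ (fun ω => (Y ω, Z ω)) := by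
  have key : ∑ ω, μ ω * (Real.log (pmass μ (fun ω => (X ω, Z ω)) (X ω, Z ω))
      + Real.log (pmass μ (fun ω => (Y ω, Z ω)) (Y ω, Z ω))
      - Real.log (pmass μ (fun ω => (X ω, Y ω, Z ω)) (X ω, Y ω, Z ω))
      - Real.log (pmass μ Z (Z ω))) ≤ 0 := by
    let F : S × T × U → ℝ := fun q =>
      pmass μ (fun ω => (X ω, Z ω)) (q.1, q.2.2) * pmass μ (fun ω => (Y ω, Z ω)) q.2
        / (pmass μ (fun ω => (X ω, Y ω, Z ω)) q * pmass μ Z q.2.2)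
    have h1 : ∀ ω, μ ω * (Real.log (pmass μ (fun ω => (X ω, Z ω)) (X ω, Z ω))
      + Real.log (pmass μ (fun ω => (Y ω, Z ω)) (Y ω, Z ω))
      - Real.log (pmass μ (fun ω => (X ω, Y ω, Z ω)) (X ω, Y ω, Z ω))
      - Real.log (pmass μ Z (Z ω))) ≤ μ ω * F (X ω, Y ω, Z ω) - μ ω := by
      intro ω
      rcases (hμ.1 ω).eq_or_lt with h | h
      · simp [← h]
      · have a1 := h.trans_le (le_pmass hμ (fun ω => (X ω, Z ω)) ω)
        have a2 := h.trans_le (le_pmass hμ (fun ω => (Y ω, Z ω)) ω)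
        have a3 := h.trans_le (le_pmass hμ (fun ω => (X ω, Y ω, Z ω)) ω)
        have a4 := h.trans_le (le_pmass hμ Z ω)
        have : Real.log (F (X ω, Y ω, Z ω)) ≤ F (X ω, Y ω, Z ω) - 1 := by
          apply Real.log_le_sub_one_of_pos
          dsimp only [F]
          positivity
        have e : Real.log (F (X ω, Y ω, Z ω)) =
          (Real.log (pmass μ (fun ω => (X ω, Z ω)) (X ω, Z ω))
          + Real.log (pmass μ (fun ω => (Y ω, Z ω)) (Y ω, Z ω))
          - Real.log (pmass μ (fun ω => (X ω, Y ω, Z ω)) (X ω, Y ω, Z ω))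
          - Real.log (pmass μ Z (Z ω))) := by
          dsimp only [F]
          rw [Real.log_div (by positivity) (by positivity), Real.log_mul a1.ne' a2.ne',
            Real.log_mul a3.ne' a4.ne']
          ring
        rw [← e]
        nlinarith
    refine (Finset.sum_le_sum (fun ω _ => h1 ω)).trans ?_
    rw [Finset.sum_sub_distrib, hμ.2, pushes_law μ (fun ω => (X ω, Y ω, Z ω)) F]
    have h2 : ∀ q, pmass μ (fun ω => (X ω, Y ω, Z ω)) q * F q ≤
        pmass μ (fun ω => (X ω, Z ω)) (q.1, q.2.2) * pmass μ (fun ω => (Y ω, Z ω)) q.2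
        / pmass μ Z q.2.2 := by
      intro q
      have b1 := pmass_nonneg hμ (fun ω => (X ω, Z ω)) (q.1, q.2.2)
      have b2 := pmass_nonneg hμ (fun ω => (Y ω, Z ω)) q.2
      have b4 := pmass_nonneg hμ Z q.2.2
      rcases (pmass_nonneg hμ (fun ω => (X ω, Y ω, Z ω)) q).eq_or_lt with h | h
      · rw [← h, zero_mul]; positivity
      · apply le_of_eq
        dsimp only [F]
        rw [mul_div_assoc', mul_div_mul_left _ _ h.ne']
    have h3 : ∑ q : S × T × U, pmass μ (fun ω => (X ω, Z ω)) (q.1, q.2.2) *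
        pmass μ (fun ω => (Y ω, Z ω)) q.2 / pmass μ Z q.2.2 = 1 := by
      rw [← pmass_sum hμ Z]
      simp only [Fintype.sum_prod_type]
      rw [Finset.sum_comm]
      simp only [Finset.sum_comm (s := (Finset.univ : Finset S))]
      rw [Finset.sum_comm]
      apply Finset.sum_congr rfl
      intro z _
      simp only [← Finset.sum_div, ← Finset.sum_mul, ← Finset.mul_sum, sum_pmass_fst]
      by_cases h : pmass μ Z z = 0
      · simp [h]
      · field_simp
    have := Finset.sum_le_sum (s := Finset.univ) (fun q _ => h2 q)
    linarith
  rw [ent_eq_exp, ent_eq_exp, ent_eq_exp, ent_eq_exp, ← Finset.sum_add_distrib,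
    ← Finset.sum_add_distrib, ← sub_nonpos, ← Finset.sum_sub_distrib]
  refine le_trans (le_of_eq ?_) key
  apply Finset.sum_congr rfl
  intro ω _
  ring

lemma ent_ci {μ : Ω → ℝ} (hμ : IsProb μ) (X : Ω → S) (Y : Ω → T) (Z : Ω → U)
    (h : ∀ x y z, pmass μ (fun ω => (X ω, Y ω, Z ω)) (x, y, z) * pmass μ Z z =
      pmass μ (fun ω => (X ω, Z ω)) (x, z) * pmass μ (fun ω => (Y ω, Z ω)) (y, z)) :
    ent μ (fun ω => (X ω, Y ω, Z ω)) + ent μ Z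
      = ent μ (fun ω => (X ω, Z ω)) + ent μ (fun ω => (Y ω, Z ω)) := by
  rw [ent_eq_exp, ent_eq_exp, ent_eq_exp, ent_eq_exp, ← Finset.sum_add_distrib,
    ← Finset.sum_add_distrib]
  apply Finset.sum_congr rfl
  intro ω _
  rcases (hμ.1 ω).eq_or_lt with h0 | h0
  · simp [← h0]
  · have a1 := h0.trans_le (le_pmass hμ (fun ω => (X ω, Z ω)) ω)
    have a2 := h0.trans_le (le_pmass hμ (fun ω => (Y ω, Z ω)) ω)
    have a3 := h0.trans_le (le_pmass hμ (fun ω => (X ω, Y ω, Z ω)) ω)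
    have a4 := h0.trans_le (le_pmass hμ Z ω)
    have := congrArg Real.log (h (X ω) (Y ω) (Z ω))
    rw [Real.log_mul a3.ne' a4.ne', Real.log_mul a1.ne' a2.ne'] at this
    linear_combination (- μ ω) * this

lemma ent_unit {μ : Ω → ℝ} (hμ : IsProb μ) : ent μ (fun _ => ()) = 0 := by
  rw [ent_eq_exp]
  have : pmass μ (fun _ => ()) () = 1 := by
    simp [pmass, hμ.2]
  simp [this]

lemma ent_prod_unit {μ : Ω → ℝ} (hμ : IsProb μ) (X : Ω → S) :
    ent μ (fun ω => (X ω, ())) = ent μ X :=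
  ent_eq_of hμ Prod.fst (fun x => (x, ())) (fun _ _ => rfl) (fun _ _ => rfl)

lemma ent_subadd {μ : Ω → ℝ} (hμ : IsProb μ) (X : Ω → S) (Y : Ω → T) :
    ent μ (fun ω => (X ω, Y ω)) ≤ ent μ X + ent μ Y := by
  have := ent_submod hμ X Y (fun _ => ())
  rw [ent_unit hμ, ent_prod_unit hμ, ent_prod_unit hμ] at this
  rw [ent_eq_of hμ (X := fun ω => (X ω, Y ω)) (Y := fun ω => (X ω, Y ω, ()))
    (fun q => (q.1, q.2, ())) (fun q => (q.1, q.2.1)) (fun _ _ => rfl) (fun _ _ => rfl)]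
  linarith

lemma pmass_prod (μ : Ω → ℝ) (ν : Ω' → ℝ) (X : Ω → S) (Y : Ω' → T) (s : S) (t : T) :
    pmass (pr μ ν) (fun p => (X p.1, Y p.2)) (s, t) = pmass μ X s * pmass ν Y t := by
  simp only [pmass, pr, Fintype.sum_prod_type, Finset.sum_mul_sum]
  apply Finset.sum_congr rfl
  intro a _
  apply Finset.sum_congr rfl
  intro b _
  by_cases h : X a = s <;> by_cases h' : Y b = t <;> simp [h, h']

lemma ent_prod {μ : Ω → ℝ} {ν : Ω' → ℝ} (hμ : IsProb μ) (hν : IsProb ν) (X : Ω → S) (Y : Ω' → T) :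
    ent (pr μ ν) (fun p => (X p.1, Y p.2)) = ent μ X + ent ν Y := by
  rw [ent_eq_exp, ← (Pushes.fst μ hν).ent X, ← (Pushes.snd ν hμ).ent Y, ent_eq_exp, ent_eq_exp,
    ← Finset.sum_add_distrib]
  apply Finset.sum_congr rfl
  intro p _
  rcases ((hμ.pr hν).1 p).eq_or_lt with h | h
  · simp [← h]
  · have a1 := h.trans_le (le_pmass (hμ.pr hν) (fun p => X p.1) p)
    have a2 := h.trans_le (le_pmass (hμ.pr hν) (fun p => Y p.2) p)
    rw [(Pushes.fst μ hν).pmass X] at a1 ⊢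
    rw [(Pushes.snd ν hμ).pmass Y] at a2 ⊢
    rw [pmass_prod, Real.log_mul a1.ne' a2.ne']
    ring

lemma pmass_inj (μ : Ω → ℝ) (X : Ω → S) (f : S → T) (hf : Function.Injective f) (s : S) :
    pmass μ (fun ω => f (X ω)) (f s) = pmass μ X s := by
  simp only [pmass, hf.eq_iff]

lemma pmass_pair_le {μ : Ω → ℝ} (hμ : IsProb μ) (X : Ω → S) (Z : Ω → T) (x : S) (z : T) :
    pmass μ (fun ω => (X ω, Z ω)) (x, z) ≤ pmass μ Z z :=
  pmass_le_comp hμ (fun ω => (X ω, Z ω)) Prod.snd (x, z)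

lemma pmass_condMeas (μ : Ω → ℝ) (Z : Ω → T) (z : T) (X : Ω → S) (x : S) :
    pmass (condMeas μ Z z) X x = pmass μ (fun ω => (X ω, Z ω)) (x, z) / pmass μ Z z := by
  have e : pmass (condMeas μ Z z) X x =
      ∑ ω, if X ω = x then (if Z ω = z then μ ω / pmass μ Z z else 0) else 0 := rfl
  rw [e]
  conv_rhs => rw [pmass, Finset.sum_div]
  apply Finset.sum_congr rfl
  intro ω _
  by_cases h : X ω = x <;> by_cases h' : Z ω = z <;> simp [h, h']

lemma isProb_condMeas {μ : Ω → ℝ} (hμ : IsProb μ) (Z : Ω → T) (z : T) (hz : pmass μ Z z ≠ 0) :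
    IsProb (condMeas μ Z z) := by
  have h0 := pmass_nonneg hμ Z z
  refine ⟨fun ω => ?_, ?_⟩
  · unfold condMeas
    split_ifs
    · exact div_nonneg (hμ.1 _) h0
    · exact le_rfl
  · have : ∑ ω, condMeas μ Z z ω = pmass μ Z z / pmass μ Z z := by
      simp only [condMeas]
      conv_rhs => rw [pmass, Finset.sum_div]
      apply Finset.sum_congr rfl
      intro ω _
      split_ifs
      · rfl
      · simp
    rw [this, div_self hz]

lemma ent_chain {μ : Ω → ℝ} (hμ : IsProb μ) (X : Ω → S) (Z : Ω → T) :
    ∑ z, pmass μ Z z * ent (condMeas μ Z z) X = ent μ (fun ω => (X ω, Z ω)) - ent μ Z := by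
  rw [ent_eq_sum, ent_eq_sum, Fintype.sum_prod_type_right, ← Finset.sum_sub_distrib]
  apply Finset.sum_congr rfl
  intro z _
  rw [ent_eq_sum]
  simp only [pmass_condMeas]
  by_cases h : pmass μ Z z = 0
  · have : ∀ x, pmass μ (fun ω => (X ω, Z ω)) (x, z) = 0 := fun x =>
      le_antisymm ((pmass_pair_le hμ X Z x z).trans h.le) (pmass_nonneg hμ _ _)
    simp [h, this]
  · rw [Finset.mul_sum]
    have e : ∀ x, pmass μ Z z * Real.negMulLog
        (pmass μ (fun ω => (X ω, Z ω)) (x, z) / pmass μ Z z) =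
        Real.negMulLog (pmass μ (fun ω => (X ω, Z ω)) (x, z)) +
        pmass μ (fun ω => (X ω, Z ω)) (x, z) * Real.log (pmass μ Z z) := by
      intro x
      by_cases h' : pmass μ (fun ω => (X ω, Z ω)) (x, z) = 0
      · simp [h']
      · rw [Real.negMulLog, Real.negMulLog, Real.log_div h' h]
        field_simp
        ring
    simp only [e]
    rw [Finset.sum_add_distrib, ← Finset.sum_mul, sum_pmass_fst, Real.negMulLog]
    ring

variable {G : Type} [AddCommGroup G] [Fintype G]

/-- entropy of a pmf -/
def hp (p : G → ℝ) : ℝ := ent p (fun g => g)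

/-- entropy of a sum -/
def ee (p q : G → ℝ) : ℝ := ent (pr p q) (fun x => x.1 + x.2)

/-- distance of pmfs -/
def dm (p q : G → ℝ) : ℝ := ee p q - hp p / 2 - hp q / 2

/-- conditional distance to a pmf -/
def DD (x : G → ℝ) (μ : Ω → ℝ) (A : Ω → G) (B : Ω → T) : ℝ :=
  ent (pr x μ) (fun p => (p.1 + A p.2, B p.2)) - ent μ B - hp x / 2
    - (ent μ (fun ω => (A ω, B ω)) - ent μ B) / 2

/-- the minimum value -/
def tau (η : ℝ) (x1 x2 p1 p2 : G → ℝ) : ℝ := dm p1 p2 + η * dm x1 p1 + η * dm x2 p2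

def TauMin (η : ℝ) (x1 x2 : G → ℝ) (t : ℝ) : Prop :=
  ∀ p q, IsProb p → IsProb q → t ≤ tau η x1 x2 p q

lemma DD_push (x : G → ℝ) {μ : Ω → ℝ} {φ : Ω → Ω'} {μ' : Ω' → ℝ} (h : Pushes μ φ μ')
    (A : Ω' → G) (B : Ω' → T) :
    DD x μ (fun ω => A (φ ω)) (fun ω => B (φ ω)) = DD x μ' A B := by
  unfold DD
  rw [← ((Pushes.id x).prod h).ent (fun p => (p.1 + A p.2, B p.2)), ← h.ent B,
    ← h.ent (fun ω => (A ω, B ω))]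

lemma DD_congr (x : G → ℝ) {μ : Ω → ℝ} {A A' : Ω → G} {B B' : Ω → T}
    (h : ∀ ω, μ ω ≠ 0 → A ω = A' ω) (h' : ∀ ω, μ ω ≠ 0 → B ω = B' ω) :
    DD x μ A B = DD x μ A' B' := by
  unfold DD
  rw [ent_congr_ae h', ent_congr_ae (X := fun ω => (A ω, B ω)) (Y := fun ω => (A' ω, B' ω)),
    ent_congr_ae (X := fun p : G × Ω => (p.1 + A p.2, B p.2))
      (Y := fun p => (p.1 + A' p.2, B' p.2))]
  · intro p hp
    have : μ p.2 ≠ 0 := right_ne_zero_of_mul hp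
    simp [h _ this, h' _ this]
  · intro p hp
    simp [h _ hp, h' _ hp]

lemma DD_unit {x : G → ℝ} (hx : IsProb x) {μ : Ω → ℝ} (hμ : IsProb μ) (A : Ω → G) :
    DD x μ A (fun _ => ()) = dm x (pmass μ A) := by
  unfold DD dm ee hp
  rw [ent_unit hμ, ent_prod_unit hμ, ent_prod_unit (hx.pr hμ),
    ← (pushes_law μ A).ent (fun g => g),
    ← ((Pushes.id x).prod (pushes_law μ A)).ent (fun p => p.1 + p.2)]
  ring

lemma hmin_cond {η : ℝ} {x1 x2 : G → ℝ} {t : ℝ} (hx1 : IsProb x1) (hx2 : IsProb x2)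
    (hm : TauMin η x1 x2 t) {μ : Ω → ℝ} (hμ : IsProb μ) (A A' : Ω → G) (Z : Ω → T)
    (h : ∀ x y z, pmass μ (fun ω => (A ω, A' ω, Z ω)) (x, y, z) * pmass μ Z z =
      pmass μ (fun ω => (A ω, Z ω)) (x, z) * pmass μ (fun ω => (A' ω, Z ω)) (y, z)) :
    t ≤ (ent μ (fun ω => (A ω + A' ω, Z ω)) - ent μ Z)
      - (ent μ (fun ω => (A ω, Z ω)) - ent μ Z) / 2
      - (ent μ (fun ω => (A' ω, Z ω)) - ent μ Z) / 2
      + η * DD x1 μ A Z + η * DD x2 μ A' Z := by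
  have hz : ∀ z, pmass μ Z z * t ≤ pmass μ Z z * (ent (condMeas μ Z z) (fun ω => A ω + A' ω)
      - ent (condMeas μ Z z) A / 2 - ent (condMeas μ Z z) A' / 2
      + η * (ent (pr x1 (condMeas μ Z z)) (fun p => p.1 + A p.2) - hp x1 / 2
        - ent (condMeas μ Z z) A / 2)
      + η * (ent (pr x2 (condMeas μ Z z)) (fun p => p.1 + A' p.2) - hp x2 / 2
        - ent (condMeas μ Z z) A' / 2)) := by
    intro z
    by_cases h0 : pmass μ Z z = 0
    · simp [h0]
    apply mul_le_mul_of_nonneg_left _ (pmass_nonneg hμ Z z)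
    have hc := isProb_condMeas hμ Z z h0
    have := hm _ _ (isProb_law hc A) (isProb_law hc A')
    have pl : Pushes (condMeas μ Z z) (fun ω => (A ω, A' ω))
        (pr (pmass (condMeas μ Z z) A) (pmass (condMeas μ Z z) A')) := by
      have := pushes_law (condMeas μ Z z) (fun ω => (A ω, A' ω))
      convert this using 1
      funext ⟨a, b⟩
      simp only [pr, pmass_condMeas]
      have hh := h a b z
      have e : pmass μ (fun ω => ((A ω, A' ω), Z ω)) ((a, b), z) =
          pmass μ (fun ω => (A ω, A' ω, Z ω)) (a, b, z) := by
        simp [pmass, and_assoc]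
      rw [e]
      field_simp
      linarith
    unfold tau dm ee hp at this
    rw [← pl.ent (fun p => p.1 + p.2), ← (pushes_law (condMeas μ Z z) A).ent (fun g => g),
      ← (pushes_law (condMeas μ Z z) A').ent (fun g => g),
      ← ((Pushes.id x1).prod (pushes_law (condMeas μ Z z) A)).ent (fun p => p.1 + p.2),
      ← ((Pushes.id x2).prod (pushes_law (condMeas μ Z z) A')).ent (fun p => p.1 + p.2)] at this
    unfold hp
    linarith
  have hs := Finset.sum_le_sum (s := Finset.univ) (fun z _ => hz z)
  have c1 := ent_chain hμ (fun ω => A ω + A' ω) Z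
  have c2 := ent_chain hμ A Z
  have c3 := ent_chain hμ A' Z
  have cx : ∀ (x : G → ℝ) (hx : IsProb x) (A : Ω → G),
      ∑ z, pmass μ Z z * ent (pr x (condMeas μ Z z)) (fun p => p.1 + A p.2) =
      ent (pr x μ) (fun p => (p.1 + A p.2, Z p.2)) - ent μ Z := by
    intro x hx A
    have := ent_chain (hx.pr hμ) (fun p => p.1 + A p.2) (fun p => Z p.2)
    rw [(Pushes.snd μ hx).ent Z] at this
    rw [← this]
    apply Finset.sum_congr rfl
    intro z _
    rw [(Pushes.snd μ hx).pmass Z]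
    congr 2
    funext p
    simp only [pr, condMeas, (Pushes.snd μ hx).pmass Z]
    split_ifs
    · ring
    · simp
  have c4 := cx x1 hx1 A
  have c5 := cx x2 hx2 A'
  have c6 := pmass_sum hμ Z
  rw [← Finset.sum_mul, c6, one_mul] at hs
  refine hs.trans (le_of_eq ?_)
  unfold DD
  have e : ∀ z, pmass μ Z z * (ent (condMeas μ Z z) (fun ω => A ω + A' ω)
      - ent (condMeas μ Z z) A / 2 - ent (condMeas μ Z z) A' / 2
      + η * (ent (pr x1 (condMeas μ Z z)) (fun p => p.1 + A p.2) - hp x1 / 2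
        - ent (condMeas μ Z z) A / 2)
      + η * (ent (pr x2 (condMeas μ Z z)) (fun p => p.1 + A' p.2) - hp x2 / 2
        - ent (condMeas μ Z z) A' / 2)) =
      pmass μ Z z * ent (condMeas μ Z z) (fun ω => A ω + A' ω)
      - (1 + η) / 2 * (pmass μ Z z * ent (condMeas μ Z z) A)
      - (1 + η) / 2 * (pmass μ Z z * ent (condMeas μ Z z) A')
      + η * (pmass μ Z z * ent (pr x1 (condMeas μ Z z)) (fun p => p.1 + A p.2))
      + η * (pmass μ Z z * ent (pr x2 (condMeas μ Z z)) (fun p => p.1 + A' p.2))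
      - η / 2 * (hp x1 + hp x2) * pmass μ Z z := by
    intro z; ring
  simp only [e, Finset.sum_add_distrib, Finset.sum_sub_distrib, ← Finset.mul_sum, c1, c2, c3,
    c4, c5, c6]
  ring

lemma DD_prod_le {x : G → ℝ} (hx : IsProb x) {μ : Ω → ℝ} (hμ : IsProb μ) {ν : Ω' → ℝ}
    (hν : IsProb ν) (A : Ω → G) (B : Ω → S) (B' : Ω' → T) :
    DD x (pr μ ν) (fun p => A p.1) (fun p => (B p.1, B' p.2)) ≤ DD x μ A B := by
  unfold DD
  rw [ent_prod hμ hν]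
  have h1 : ent (pr μ ν) (fun p => (A p.1, B p.1, B' p.2)) =
      ent μ (fun ω => (A ω, B ω)) + ent ν B' := by
    rw [← ent_prod hμ hν]
    exact ent_eq_of (hμ.pr hν) (fun q => ((q.1, q.2.1), q.2.2)) (fun q => (q.1.1, q.1.2, q.2))
      (fun _ _ => rfl) (fun _ _ => rfl)
  have h2 : ent (pr x (pr μ ν)) (fun p => (p.1 + A p.2.1, B p.2.1, B' p.2.2)) ≤
      ent (pr x μ) (fun p => (p.1 + A p.2, B p.2)) + ent ν B' := by
    have := ent_subadd (hx.pr (hμ.pr hν)) (fun p => (p.1 + A p.2.1, B p.2.1)) (fun p => B' p.2.2)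
    rw [((Pushes.id x).prod (Pushes.fst μ hν)).ent (fun p => (p.1 + A p.2, B p.2)),
      (Pushes.snd (pr μ ν) hx).ent (fun p => B' p.2), (Pushes.snd ν hμ).ent B'] at this
    refine le_trans (le_of_eq ?_) this
    exact ent_eq_of (hx.pr (hμ.pr hν)) (fun q => ((q.1, q.2.1), q.2.2))
      (fun q => (q.1.1, q.1.2, q.2)) (fun _ _ => rfl) (fun _ _ => rfl)
  rw [h1]
  linarith

lemma pushes_swap (μ : Ω → ℝ) (ν : Ω' → ℝ) : Pushes (pr μ ν) (fun p => (p.2, p.1)) (pr ν μ) :=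
  Pushes.of_inv _ (fun p => (p.2, p.1)) (fun _ => rfl) (fun _ => rfl)
    (fun _ => by simp [pr, mul_comm])

lemma DD_comp_inj (x : G → ℝ) (hx : IsProb x) {μ : Ω → ℝ} (hμ : IsProb μ) (A : Ω → G) (B : Ω → S)
    (f : S → T) (g : T → S) (hg : ∀ s, g (f s) = s) :
    DD x μ A (fun ω => f (B ω)) = DD x μ A B := by
  unfold DD
  rw [ent_eq_of hμ (X := fun ω => f (B ω)) (Y := B) g f (by simp [hg]) (by simp),
    ent_eq_of hμ (X := fun ω => (A ω, f (B ω))) (Y := fun ω => (A ω, B ω))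
      (fun q => (q.1, g q.2)) (fun q => (q.1, f q.2)) (by simp [hg]) (by simp),
    ent_eq_of (hx.pr hμ) (X := fun p => (p.1 + A p.2, f (B p.2)))
      (Y := fun p => (p.1 + A p.2, B p.2))
      (fun q => (q.1, g q.2)) (fun q => (q.1, f q.2)) (by simp [hg]) (by simp)]

lemma DD_prod_le' {x : G → ℝ} (hx : IsProb x) {μ : Ω → ℝ} (hμ : IsProb μ) {ν : Ω' → ℝ}
    (hν : IsProb ν) (A : Ω' → G) (B : Ω → S) (B' : Ω' → T) :
    DD x (pr μ ν) (fun p => A p.2) (fun p => (B p.1, B' p.2)) ≤ DD x ν A B' := by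
  refine le_trans (le_of_eq ?_) (DD_prod_le hx hν hμ A B' B)
  rw [← DD_comp_inj x hx (hν.pr hμ) (fun p => A p.1) (fun p => (B' p.1, B p.2))
    (fun q => (q.2, q.1)) (fun q => (q.2, q.1)) (fun _ => rfl)]
  exact DD_push x (pushes_swap μ ν) (fun p => A p.1) (fun p => (B p.2, B' p.1))

lemma hmin_prod {η : ℝ} (hη : 0 ≤ η) {x1 x2 : G → ℝ} {t : ℝ} (hx1 : IsProb x1) (hx2 : IsProb x2)
    (hm : TauMin η x1 x2 t) {μ : Ω → ℝ} (hμ : IsProb μ) {ν : Ω' → ℝ} (hν : IsProb ν)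
    (A : Ω → G) (B : Ω → S) (A' : Ω' → G) (B' : Ω' → T) :
    t ≤ ent (pr μ ν) (fun p => (A p.1 + A' p.2, B p.1, B' p.2)) - ent μ B - ent ν B'
      - (ent μ (fun ω => (A ω, B ω)) - ent μ B) / 2
      - (ent ν (fun ω => (A' ω, B' ω)) - ent ν B') / 2
      + η * DD x1 μ A B + η * DD x2 ν A' B' := by
  have h1 : ∀ a b b', pmass (pr μ ν) (fun p => (A p.1, B p.1, B' p.2)) (a, b, b') =
      pmass μ (fun ω => (A ω, B ω)) (a, b) * pmass ν B' b' := by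
    intro a b b'
    rw [← pmass_prod]; simp [pmass, and_assoc]
  have h2 : ∀ a b b', pmass (pr μ ν) (fun p => (A' p.2, B p.1, B' p.2)) (a, b, b') =
      pmass μ B b * pmass ν (fun ω => (A' ω, B' ω)) (a, b') := by
    intro a b b'
    rw [← pmass_prod]; simp [pmass, and_left_comm]
  have h3 : ∀ a a' b b', pmass (pr μ ν) (fun p => (A p.1, A' p.2, B p.1, B' p.2)) (a, a', b, b') =
      pmass μ (fun ω => (A ω, B ω)) (a, b) * pmass ν (fun ω => (A' ω, B' ω)) (a', b') := by
    intro a a' b b'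
    rw [← pmass_prod]; simp [pmass, and_assoc, and_left_comm]
  have := hmin_cond hx1 hx2 hm (hμ.pr hν) (fun p => A p.1) (fun p => A' p.2)
    (fun p => (B p.1, B' p.2)) (by
      rintro a a' ⟨b, b'⟩
      rw [h1, h2, h3, pmass_prod]; ring)
  have d1 := mul_le_mul_of_nonneg_left (DD_prod_le hx1 hμ hν A B B') hη
  have d2 := mul_le_mul_of_nonneg_left (DD_prod_le' hx2 hμ hν A' B B') hη
  have e1 : ent (pr μ ν) (fun p => (A p.1, B p.1, B' p.2)) =
      ent μ (fun ω => (A ω, B ω)) + ent ν B' := by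
    rw [← ent_prod hμ hν]
    exact ent_eq_of (hμ.pr hν) (fun q => ((q.1, q.2.1), q.2.2)) (fun q => (q.1.1, q.1.2, q.2))
      (fun _ _ => rfl) (fun _ _ => rfl)
  have e2 : ent (pr μ ν) (fun p => (A' p.2, B p.1, B' p.2)) =
      ent μ B + ent ν (fun ω => (A' ω, B' ω)) := by
    rw [← ent_prod hμ hν]
    exact ent_eq_of (hμ.pr hν) (fun q => (q.2.1, (q.1, q.2.2))) (fun q => (q.2.1, q.1, q.2.2))
      (fun _ _ => rfl) (fun _ _ => rfl)
  rw [e1, e2, ent_prod hμ hν] at this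
  linarith

lemma DD_unit' {x : G → ℝ} (hx : IsProb x) {μ : Ω → ℝ} (hμ : IsProb μ) (A : Ω → G) :
    DD x μ A (fun _ => ()) = ent (pr x μ) (fun p => p.1 + A p.2) - hp x / 2 - ent μ A / 2 := by
  unfold DD
  rw [ent_unit hμ, ent_prod_unit hμ, ent_prod_unit (hx.pr hμ)]
  ring

lemma pushes_assoc (x : Ω → ℝ) (μ : Ω' → ℝ) (ν : Ω'' → ℝ) :
    Pushes (pr x (pr μ ν)) (fun p => ((p.1, p.2.1), p.2.2)) (pr (pr x μ) ν) :=
  Pushes.of_inv _ (fun p => (p.1.1, p.1.2, p.2)) (fun _ => rfl) (fun _ => rfl)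
    (fun _ => by simp [pr, mul_assoc])

lemma DD_a {x : G → ℝ} (hx : IsProb x) {μ : Ω → ℝ} (hμ : IsProb μ) {ν : Ω' → ℝ}
    (hν : IsProb ν) (Y : Ω → G) (Z : Ω' → G) :
    DD x (pr μ ν) (fun p => Y p.1 + Z p.2) (fun _ => ()) ≤ DD x μ Y (fun _ => ())
      + (ent (pr μ ν) (fun p => Y p.1 + Z p.2) - ent μ Y) / 2 := by
  rw [DD_unit' hx (hμ.pr hν), DD_unit' hx hμ]
  have hP := hx.pr (hμ.pr hν)
  have h := ent_submod hP (fun p => p.1) (fun p => Z p.2.2) (fun p => p.1 + (Y p.2.1 + Z p.2.2))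
  have e1 : ent (pr x (pr μ ν)) (fun p => (p.1, Z p.2.2, p.1 + (Y p.2.1 + Z p.2.2))) =
      hp x + (ent μ Y + ent ν Z) := by
    unfold hp
    rw [← ent_prod hμ hν, ← ent_prod hx (hμ.pr hν)]
    exact ent_eq_of hP (fun q => (q.1, q.2.2 - q.1 - q.2.1, q.2.1))
      (fun q => (q.1, q.2.2, q.1 + (q.2.1 + q.2.2)))
      (fun _ _ => by simp) (fun _ _ => rfl)
  have e2 : ent (pr x (pr μ ν)) (fun p => (p.1, p.1 + (Y p.2.1 + Z p.2.2))) =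
      hp x + ent (pr μ ν) (fun p => Y p.1 + Z p.2) := by
    unfold hp
    rw [← ent_prod hx (hμ.pr hν)]
    exact ent_eq_of hP (fun q => (q.1, q.2 - q.1)) (fun q => (q.1, q.1 + q.2))
      (fun _ _ => by simp) (fun _ _ => rfl)
  have e3 : ent (pr x (pr μ ν)) (fun p => (Z p.2.2, p.1 + (Y p.2.1 + Z p.2.2))) =
      ent (pr x μ) (fun p => p.1 + Y p.2) + ent ν Z := by
    rw [← ent_prod (hx.pr hμ) hν, ← (pushes_assoc x μ ν).ent]
    exact ent_eq_of hP (fun q => (q.2 - q.1, q.1)) (fun q => (q.2, q.1 + q.2))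
      (fun _ _ => by simp [← add_assoc]) (fun _ _ => by simp; abel)
  rw [e1, e2, e3] at h
  linarith

lemma DD_b {x : G → ℝ} (hx : IsProb x) {μ : Ω → ℝ} (hμ : IsProb μ) {ν : Ω' → ℝ}
    (hν : IsProb ν) (Y : Ω → G) (Z : Ω' → G) :
    DD x (pr μ ν) (fun p => Y p.1) (fun p => Y p.1 + Z p.2) ≤ DD x μ Y (fun _ => ())
      + (ent (pr μ ν) (fun p => Y p.1 + Z p.2) - ent ν Z) / 2 := by
  rw [DD_unit' hx hμ]
  unfold DD
  have hP := hx.pr (hμ.pr hν)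
  have h := ent_subadd hP (fun p => p.1 + Y p.2.1) (fun p => Y p.2.1 + Z p.2.2)
  rw [(Pushes.snd (pr μ ν) hx).ent (fun p => Y p.1 + Z p.2),
    ((Pushes.id x).prod (Pushes.fst μ hν)).ent (fun p => p.1 + Y p.2)] at h
  have e1 : ent (pr μ ν) (fun p => (Y p.1, Y p.1 + Z p.2)) = ent μ Y + ent ν Z := by
    rw [← ent_prod hμ hν]
    exact ent_eq_of (hμ.pr hν) (fun q => (q.1, q.2 - q.1)) (fun q => (q.1, q.1 + q.2))
      (fun _ _ => by simp) (fun _ _ => rfl)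
  rw [e1]
  linarith

lemma DD_cond_le {x : G → ℝ} (hx : IsProb x) {μ : Ω → ℝ} (hμ : IsProb μ)
    (A : Ω → G) (C : Ω → T) (R : Ω → S) :
    DD x μ A (fun ω => (C ω, R ω)) ≤ DD x μ A R +
      (ent μ (fun ω => (A ω, R ω)) + ent μ (fun ω => (C ω, R ω))
        - ent μ (fun ω => (A ω, C ω, R ω)) - ent μ R) / 2 := by
  unfold DD
  have h := ent_submod (hx.pr hμ) (fun p => p.1 + A p.2) (fun p => C p.2) (fun p => R p.2)
  rw [(Pushes.snd μ hx).ent R, (Pushes.snd μ hx).ent (fun ω => (C ω, R ω))] at h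
  linarith

/-- conditionally independent copies -/
def ci (μ : Ω → ℝ) (Z : Ω → T) : Ω × Ω → ℝ :=
  fun p => if Z p.1 = Z p.2 then μ p.1 * μ p.2 / pmass μ Z (Z p.1) else 0

lemma ci_symm (μ : Ω → ℝ) (Z : Ω → T) (a b : Ω) : ci μ Z (a, b) = ci μ Z (b, a) := by
  unfold ci
  by_cases h : Z a = Z b
  · simp [h, mul_comm]
  · simp [h, Ne.symm h]

lemma ci_fst {μ : Ω → ℝ} (hμ : IsProb μ) (Z : Ω → T) : Pushes (ci μ Z) Prod.fst μ := by
  intro F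
  rw [Fintype.sum_prod_type]
  apply Finset.sum_congr rfl
  intro a _
  dsimp only
  rw [← Finset.sum_mul]
  congr 1
  have : ∀ b, ci μ Z (a, b) = μ a * ((if Z b = Z a then μ b else 0) / pmass μ Z (Z a)) := by
    intro b
    unfold ci
    by_cases h : Z a = Z b
    · simp [h, mul_div_assoc]
    · simp [h, Ne.symm h]
  simp only [this]
  rw [← Finset.mul_sum, ← Finset.sum_div]
  change μ a * (pmass μ Z (Z a) / pmass μ Z (Z a)) = μ a
  rcases (hμ.1 a).eq_or_lt with h | h
  · simp [← h]
  · rw [div_self (h.trans_le (le_pmass hμ Z a)).ne', mul_one]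

lemma ci_snd {μ : Ω → ℝ} (hμ : IsProb μ) (Z : Ω → T) : Pushes (ci μ Z) Prod.snd μ := by
  intro F
  rw [← ci_fst hμ Z F, Fintype.sum_prod_type, Fintype.sum_prod_type, Finset.sum_comm]
  apply Finset.sum_congr rfl
  intro a _
  apply Finset.sum_congr rfl
  intro b _
  rw [ci_symm]

lemma ci_prob {μ : Ω → ℝ} (hμ : IsProb μ) (Z : Ω → T) : IsProb (ci μ Z) := by
  refine ⟨fun p => ?_, ?_⟩
  · unfold ci
    split_ifs
    · exact div_nonneg (mul_nonneg (hμ.1 _) (hμ.1 _)) (pmass_nonneg hμ _ _)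
    · exact le_rfl
  · have := ci_fst hμ Z (fun _ => 1)
    simp only [mul_one] at this
    rw [this, hμ.2]

lemma ci_ne {μ : Ω → ℝ} {Z : Ω → T} {p : Ω × Ω} (h : ci μ Z p ≠ 0) : Z p.1 = Z p.2 := by
  by_contra h'
  exact h (by simp [ci, h'])

lemma ci_ci {μ : Ω → ℝ} (hμ : IsProb μ) (Z : Ω → T) (X : Ω → S) (Y : Ω → U) (x : S) (y : U)
    (z : T) :
    pmass (ci μ Z) (fun p => (X p.1, Y p.2, Z p.1)) (x, y, z) * pmass (ci μ Z) (fun p => Z p.1) z =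
      pmass (ci μ Z) (fun p => (X p.1, Z p.1)) (x, z) *
      pmass (ci μ Z) (fun p => (Y p.2, Z p.1)) (y, z) := by
  rw [(ci_fst hμ Z).pmass Z, (ci_fst hμ Z).pmass (fun ω => (X ω, Z ω)),
    pmass_congr_ae (X := fun p : Ω × Ω => (Y p.2, Z p.1)) (Y := fun p => (Y p.2, Z p.2))
      (fun p hp => by simp [ci_ne hp]),
    (ci_snd hμ Z).pmass (fun ω => (Y ω, Z ω))]
  by_cases h0 : pmass μ Z z = 0
  · have : pmass μ (fun ω => (X ω, Z ω)) (x, z) = 0 :=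
      le_antisymm ((pmass_pair_le hμ X Z x z).trans h0.le) (pmass_nonneg hμ _ _)
    rw [h0, this]; simp
  · have e : pmass (ci μ Z) (fun p => (X p.1, Y p.2, Z p.1)) (x, y, z) =
      pmass μ (fun ω => (X ω, Z ω)) (x, z) * pmass μ (fun ω => (Y ω, Z ω)) (y, z) /
        pmass μ Z z := by
      rw [← pmass_prod]
      conv_lhs => rw [pmass]
      conv_rhs => rw [pmass, Finset.sum_div]
      apply Finset.sum_congr rfl
      rintro ⟨a, b⟩ _
      simp only [ci, pr, Prod.mk.injEq]
      by_cases h1 : X a = x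
      · by_cases h2 : Y b = y
        · by_cases h3 : Z a = z
          · by_cases h4 : Z b = z
            · simp [h1, h2, h3, h4]
            · simp [h1, h2, h3, h4, Ne.symm h4]
          · simp [h3]
        · simp [h2]
      · simp [h1]
    rw [e]
    field_simp

lemma hmin_bsg {η : ℝ} (hη : 0 ≤ η) {x1 x2 : G → ℝ} {t : ℝ} (hx1 : IsProb x1) (hx2 : IsProb x2)
    (hm : TauMin η x1 x2 t) {μ : Ω → ℝ} (hμ : IsProb μ) (A B C : Ω → G) (R : Ω → T)
    (hC : ∀ ω, C ω = A ω + B ω) (h2 : ∀ g : G, g + g = 0) :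
    t ≤ 3 * (ent μ (fun ω => (A ω, R ω)) + ent μ (fun ω => (B ω, R ω))
        - ent μ (fun ω => (A ω, B ω, R ω)) - ent μ R)
      + 2 * ent μ (fun ω => (C ω, R ω)) - ent μ (fun ω => (A ω, R ω))
      - ent μ (fun ω => (B ω, R ω))
      + η * (DD x1 μ A R + (ent μ (fun ω => (A ω, R ω)) + ent μ (fun ω => (C ω, R ω))
        - ent μ (fun ω => (A ω, B ω, R ω)) - ent μ R) / 2)
      + η * (DD x2 μ B R + (ent μ (fun ω => (B ω, R ω)) + ent μ (fun ω => (C ω, R ω))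
        - ent μ (fun ω => (A ω, B ω, R ω)) - ent μ R) / 2) := by
  set Z : Ω → G × T := fun ω => (C ω, R ω) with hZ
  have hP := ci_prob hμ Z
  have hf := ci_fst hμ Z
  have hs := ci_snd hμ Z
  have hz : ∀ p, ci μ Z p ≠ 0 → A p.1 + B p.1 = A p.2 + B p.2 ∧ R p.1 = R p.2 := by
    intro p hp
    have := ci_ne hp
    simp only [hZ, Prod.mk.injEq, hC] at this
    exact this
  have main := hmin_cond hx1 hx2 hm hP (fun p => A p.1) (fun p => B p.2) (fun p => Z p.1)
    (ci_ci hμ Z A B)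
  have eAC : ent μ (fun ω => (A ω, C ω, R ω)) = ent μ (fun ω => (A ω, B ω, R ω)) :=
    ent_eq_of hμ (fun q => (q.1, q.2.1 - q.1, q.2.2)) (fun q => (q.1, q.1 + q.2.1, q.2.2))
      (fun ω _ => by simp [hC]) (fun ω _ => by simp [hC])
  have eBC : ent μ (fun ω => (B ω, C ω, R ω)) = ent μ (fun ω => (A ω, B ω, R ω)) :=
    ent_eq_of hμ (fun q => (q.2.1 - q.1, q.1, q.2.2)) (fun q => (q.2.1, q.1 + q.2.1, q.2.2))
      (fun ω _ => by simp [hC]) (fun ω _ => by simp [hC])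
  have d1 : DD x1 (ci μ Z) (fun p => A p.1) (fun p => Z p.1) = DD x1 μ A Z := DD_push x1 hf A Z
  have d2 : DD x2 (ci μ Z) (fun p => B p.2) (fun p => Z p.1) = DD x2 μ B Z := by
    rw [← DD_push x2 hs B Z]
    exact DD_congr x2 (fun _ _ => rfl) (fun p hp => ci_ne hp)
  have d1' := DD_cond_le hx1 hμ A C R
  have d2' := DD_cond_le hx2 hμ B C R
  rw [eAC] at d1'
  rw [eBC] at d2'
  have d1'' := mul_le_mul_of_nonneg_left d1' hη
  have d2'' := mul_le_mul_of_nonneg_left d2' hη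
  have f1 : ent (ci μ Z) (fun p => Z p.1) = ent μ (fun ω => (C ω, R ω)) := hf.ent Z
  have f2 : ent (ci μ Z) (fun p => (A p.1, Z p.1)) = ent μ (fun ω => (A ω, B ω, R ω)) := by
    rw [← eAC]; exact hf.ent (fun ω => (A ω, Z ω))
  have f3 : ent (ci μ Z) (fun p => (B p.2, Z p.1)) = ent μ (fun ω => (A ω, B ω, R ω)) := by
    rw [← eBC, ← hs.ent (fun ω => (B ω, C ω, R ω))]
    exact ent_congr_ae (fun p hp => by rw [ci_ne hp])
  -- bound on the joint entropy
  have g1 := ent_submod hP (fun p => A p.1 + B p.2) (fun p => C p.1) (fun p => R p.1)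
  rw [hf.ent (fun ω => (C ω, R ω)), hf.ent R] at g1
  have g2 := ent_submod hP (fun p => A p.1) (fun p => B p.1) (fun p => (A p.1 + B p.2, R p.1))
  have g3 : ent (ci μ Z) (fun p => (A p.1, A p.1 + B p.2, R p.1)) + ent μ R ≤
      ent μ (fun ω => (A ω, R ω)) + ent μ (fun ω => (B ω, R ω)) := by
    have := ent_submod hP (fun p => A p.1) (fun p => B p.2) (fun p => R p.1)
    rw [hf.ent R, hf.ent (fun ω => (A ω, R ω)),
      ent_congr_ae (X := fun p : Ω × Ω => (B p.2, R p.1)) (Y := fun p => (B p.2, R p.2))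
        (fun p hp => by rw [(hz p hp).2]), hs.ent (fun ω => (B ω, R ω))] at this
    refine le_trans (le_of_eq ?_) this
    congr 1
    exact ent_eq_of hP (fun q => (q.1, q.2.1 - q.1, q.2.2)) (fun q => (q.1, q.1 + q.2.1, q.2.2))
      (fun ω _ => by simp) (fun ω _ => by simp)
  have g4 : ent (ci μ Z) (fun p => (B p.1, A p.1 + B p.2, R p.1)) + ent μ R ≤
      ent μ (fun ω => (A ω, R ω)) + ent μ (fun ω => (B ω, R ω)) := by
    have := ent_submod hP (fun p => A p.2) (fun p => B p.1) (fun p => R p.1)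
    rw [hf.ent R, hf.ent (fun ω => (B ω, R ω)),
      ent_congr_ae (X := fun p : Ω × Ω => (A p.2, R p.1)) (Y := fun p => (A p.2, R p.2))
        (fun p hp => by rw [(hz p hp).2]), hs.ent (fun ω => (A ω, R ω))] at this
    refine le_trans (le_of_eq ?_) this
    congr 1
    have key : ∀ p, ci μ Z p ≠ 0 → A p.1 + B p.2 = B p.1 + A p.2 := by
      intro p hp
      have e := (hz p hp).1
      have h3 := h2 (B p.1)
      have h4 := h2 (B p.2)
      calc A p.1 + B p.2 = (A p.1 + B p.1) + B p.2 + B p.1 - (B p.1 + B p.1) := by abel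
        _ = (A p.2 + B p.2) + B p.2 + B p.1 := by rw [e, h3, sub_zero]
        _ = (B p.2 + B p.2) + B p.1 + A p.2 := by abel
        _ = _ := by rw [h4, zero_add]
    exact ent_eq_of hP (fun q => (q.2.1 - q.1, q.1, q.2.2))
      (fun q => (q.2.1, q.2.1 + q.1, q.2.2))
      (fun ω h => by simp [key ω h]) (fun ω h => by simp [key ω h])
  have g5 : ent (ci μ Z) (fun p => (A p.1, B p.1, A p.1 + B p.2, R p.1))
      = 2 * ent μ (fun ω => (A ω, B ω, R ω)) - ent μ (fun ω => (C ω, R ω)) := by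
    have := ent_ci hP (fun p => A p.1) (fun p => B p.2) (fun p => Z p.1) (ci_ci hμ Z A B)
    rw [f1, f2, f3] at this
    have e : ent (ci μ Z) (fun p => (A p.1, B p.1, A p.1 + B p.2, R p.1)) =
      ent (ci μ Z) (fun p => (A p.1, B p.2, Z p.1)) :=
      ent_eq_of hP (fun q => (q.1, q.2.2.1 - q.1, q.1 + q.2.1, q.2.2.2))
        (fun q => (q.1, q.2.2.1 - q.1, q.1 + q.2.1, q.2.2.2))
        (fun p _ => by simp [hZ, hC]) (fun p _ => by simp [hZ, hC])
    linarith
  rw [f1, f2, f3, d1, d2] at main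
  have g1' : ent (ci μ Z) (fun p => (A p.1 + B p.2, Z p.1)) + ent μ R ≤
    ent (ci μ Z) (fun p => (A p.1 + B p.2, R p.1)) + ent μ (fun ω => (C ω, R ω)) := g1
  linarith

lemma DD_shift {x : G → ℝ} (hx : IsProb x) {μ : Ω → ℝ} (hμ : IsProb μ) (A R : Ω → G) :
    DD x μ (fun ω => R ω + A ω) R = DD x μ A R := by
  unfold DD
  rw [ent_eq_of hμ (X := fun ω => (R ω + A ω, R ω)) (Y := fun ω => (A ω, R ω))
      (fun q => (q.1 - q.2, q.2)) (fun q => (q.2 + q.1, q.2)) (by simp) (by simp),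
    ent_eq_of (hx.pr hμ) (X := fun p => (p.1 + (R p.2 + A p.2), R p.2))
      (Y := fun p => (p.1 + A p.2, R p.2))
      (fun q => (q.1 - q.2, q.2)) (fun q => (q.1 + q.2, q.2))
      (fun p _ => by simp; abel) (fun p _ => by simp; abel)]

lemma dm_eq_DD {x p : G → ℝ} (hx : IsProb x) (hp : IsProb p) :
    DD x p (fun g => g) (fun _ => ()) = dm x p := by
  rw [DD_unit hx hp, pmass_id]

lemma ee_comm (p q : G → ℝ) : ee p q = ee q p := by
  unfold ee
  rw [← (pushes_swap p q).ent]
  congr 1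
  funext x
  exact add_comm _ _

lemma DD_a1 {x p q : G → ℝ} (hx : IsProb x) (hP : IsProb p) (hq : IsProb q) :
    DD x (pr p q) (fun z => z.1 + z.2) (fun _ => ()) ≤ dm x p + (ee p q - hp p) / 2 := by
  rw [← dm_eq_DD hx hP]
  exact DD_a hx hP hq (fun g => g) (fun g => g)

lemma DD_a2 {x p q : G → ℝ} (hx : IsProb x) (hP : IsProb p) (hq : IsProb q) :
    DD x (pr p q) (fun z => z.1 + z.2) (fun _ => ()) ≤ dm x q + (ee p q - hp q) / 2 := by
  have := DD_a1 hx hq hP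
  rw [ee_comm q p, ← DD_push x (pushes_swap p q) (fun z => z.1 + z.2) (fun _ => ())] at this
  simpa only [add_comm] using this

lemma DD_b1 {x p q : G → ℝ} (hx : IsProb x) (hP : IsProb p) (hq : IsProb q) :
    DD x (pr p q) (fun z => z.1) (fun z => z.1 + z.2) ≤ dm x p + (ee p q - hp q) / 2 := by
  rw [← dm_eq_DD hx hP]
  exact DD_b hx hP hq (fun g => g) (fun g => g)

lemma DD_b2 {x p q : G → ℝ} (hx : IsProb x) (hP : IsProb p) (hq : IsProb q) :
    DD x (pr p q) (fun z => z.2) (fun z => z.1 + z.2) ≤ dm x q + (ee p q - hp p) / 2 := by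
  have := DD_b1 hx hq hP
  rw [ee_comm q p, ← DD_push x (pushes_swap p q) (fun z => z.1) (fun z => z.1 + z.2)] at this
  simpa only [add_comm] using this

lemma ent_sum_pair1 {p q : G → ℝ} (hP : IsProb p) (hq : IsProb q) :
    ent (pr p q) (fun z => (z.1, z.1 + z.2)) = hp p + hp q := by
  unfold hp
  rw [← ent_prod hP hq]
  exact ent_eq_of (hP.pr hq) (fun z => (z.1, z.2 - z.1)) (fun z => (z.1, z.1 + z.2))
    (by simp) (by simp)

lemma ent_sum_pair2 {p q : G → ℝ} (hP : IsProb p) (hq : IsProb q) :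
    ent (pr p q) (fun z => (z.2, z.1 + z.2)) = hp p + hp q := by
  unfold hp
  rw [← ent_prod hP hq]
  exact ent_eq_of (hP.pr hq) (fun z => (z.2 - z.1, z.1)) (fun z => (z.2, z.1 + z.2))
    (by simp) (by simp)

lemma ent_triple_unit {μ : Ω → ℝ} (hμ : IsProb μ) (X : Ω → S) :
    ent μ (fun ω => (X ω, (), ())) = ent μ X :=
  ent_eq_of hμ Prod.fst (fun x => (x, (), ())) (fun _ _ => rfl) (fun _ _ => rfl)

lemma char2 (h2 : ∀ g : G, g + g = 0) (a b : G) : a + b + b = a := by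
  rw [add_assoc, h2, add_zero]

lemma k_le_zero (h2 : ∀ g : G, g + g = 0) {x1 x2 p1 p2 : G → ℝ} (hx1 : IsProb x1)
    (hx2 : IsProb x2) (hp1 : IsProb p1) (hp2 : IsProb p2)
    (hm : TauMin (1/9) x1 x2 (tau (1/9) x1 x2 p1 p2)) : dm p1 p2 ≤ 0 := by
  have hη : (0:ℝ) ≤ 1/9 := by norm_num
  have hQ := hp1.pr hp2
  set M := pr (pr p1 p2) (pr p1 p2) with hMdef
  have hM : IsProb M := hQ.pr hQ
  let U : (G × G) × (G × G) → G := fun w => w.1.1 + w.1.2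
  let V : (G × G) × (G × G) → G := fun w => w.2.1 + w.1.2
  let W : (G × G) × (G × G) → G := fun w => w.1.1 + w.2.1
  let R : (G × G) × (G × G) → G := fun w => (w.1.1 + w.1.2) + (w.2.1 + w.2.2)
  have hUV : ∀ w, W w = U w + V w := fun w => by
    have := h2 w.1.2
    calc W w = w.1.1 + w.2.1 + (w.1.2 + w.1.2) := by rw [this, add_zero]
      _ = _ := by simp only [U, V]; abel
  have hVU : ∀ w, W w = V w + U w := fun w => by rw [hUV, add_comm]
  have hVW : ∀ w, U w = V w + W w := fun w => by
    rw [hVU, ← add_assoc, h2, zero_add]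
  have hWV : ∀ w, U w = W w + V w := fun w => by rw [hVW, add_comm]
  have hUW : ∀ w, V w = U w + W w := fun w => by
    rw [hUV, ← add_assoc, h2, zero_add]
  have hWU : ∀ w, V w = W w + U w := fun w => by rw [hUW, add_comm]
  -- joint entropies
  set j := ent M (fun w => (U w, V w, R w)) with hj
  have jVU : ent M (fun w => (V w, U w, R w)) = j :=
    ent_eq_of hM (fun q => (q.2.1, q.1, q.2.2)) (fun q => (q.2.1, q.1, q.2.2))
      (fun _ _ => rfl) (fun _ _ => rfl)
  have jUW : ent M (fun w => (U w, W w, R w)) = j :=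
    ent_eq_of hM (fun q => (q.1, q.1 + q.2.1, q.2.2)) (fun q => (q.1, q.1 + q.2.1, q.2.2))
      (fun w _ => by simp only [hUW w]) (fun w _ => by simp only [hUV w])
  have jWU : ent M (fun w => (W w, U w, R w)) = j := by
    rw [← jUW]
    exact ent_eq_of hM (fun q => (q.2.1, q.1, q.2.2)) (fun q => (q.2.1, q.1, q.2.2))
      (fun _ _ => rfl) (fun _ _ => rfl)
  have jVW : ent M (fun w => (V w, W w, R w)) = j := by
    rw [← jVU]
    exact ent_eq_of hM (fun q => (q.1, q.1 + q.2.1, q.2.2)) (fun q => (q.1, q.1 + q.2.1, q.2.2))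
      (fun w _ => by simp only [hVW w]) (fun w _ => by simp only [hVU w])
  have jWV : ent M (fun w => (W w, V w, R w)) = j := by
    rw [← jVW]
    exact ent_eq_of hM (fun q => (q.2.1, q.1, q.2.2)) (fun q => (q.2.1, q.1, q.2.2))
      (fun _ _ => rfl) (fun _ _ => rfl)
  -- permutations
  have sw : Pushes M (fun w => ((w.2.1, w.1.2), (w.1.1, w.2.2))) M :=
    Pushes.of_inv _ (fun w => ((w.2.1, w.1.2), (w.1.1, w.2.2))) (fun _ => rfl) (fun _ => rfl)
      (fun w => by simp only [hMdef, pr]; ring)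
  have pi1 : Pushes M (fun w => ((w.1.1, w.2.1), (w.1.2, w.2.2))) (pr (pr p1 p1) (pr p2 p2)) :=
    Pushes.of_inv _ (fun w => ((w.1.1, w.2.1), (w.1.2, w.2.2))) (fun _ => rfl) (fun _ => rfl)
      (fun w => by simp only [hMdef, pr]; ring)
  have pi2 : Pushes M (fun w => ((w.1.2, w.2.2), (w.1.1, w.2.1))) (pr (pr p2 p2) (pr p1 p1)) :=
    Pushes.of_inv _ (fun w => ((w.2.1, w.1.1), (w.2.2, w.1.2))) (fun _ => rfl) (fun _ => rfl)
      (fun w => by simp only [hMdef, pr]; ring)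
  have R1 : ∀ w : (G × G) × (G × G), R ((w.2.1, w.1.2), (w.1.1, w.2.2)) = R w := fun w => by
    simp only [R]; abel
  have R2 : ∀ w : (G × G) × (G × G), R ((w.1.1, w.2.1), (w.1.2, w.2.2)) = R w := fun w => by
    simp only [R]; abel
  have R3 : ∀ w : (G × G) × (G × G), R ((w.1.2, w.2.2), (w.1.1, w.2.1)) = R w := fun w => by
    simp only [R]; abel
  have eUR : ent M (fun w => (U w, R w)) = 2 * ee p1 p2 := by
    have : ent M (fun w => (U w, R w)) = ee p1 p2 + ee p1 p2 := by
      unfold ee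
      rw [← ent_prod hQ hQ]
      exact ent_eq_of hM (fun q => (q.1, q.2 - q.1)) (fun q => (q.1, q.1 + q.2))
        (fun w _ => by simp [U, R]) (fun w _ => by simp [U, R])
    linarith
  have eVR : ent M (fun w => (V w, R w)) = 2 * ee p1 p2 := by
    rw [← eUR, ← sw.ent]
    simp only [R1]
    rfl
  have eWR : ent M (fun w => (W w, R w)) = ee p1 p1 + ee p2 p2 := by
    unfold ee
    rw [← ent_prod (hp1.pr hp1) (hp2.pr hp2), ← pi1.ent]
    exact ent_eq_of hM (fun q => (q.1, q.2 - q.1)) (fun q => (q.1, q.1 + q.2))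
        (fun w _ => by simp only [W, R]; congr 1; abel)
        (fun w _ => by simp only [W, R]; congr 1; abel)
  set s := ent M R with hs
  have s2 : ent (pr (pr p1 p1) (pr p2 p2)) R = s := by
    rw [← pi1.ent]; simp only [R2]; rfl
  have s3 : ent (pr (pr p2 p2) (pr p1 p1)) R = s := by
    rw [← pi2.ent]; simp only [R3]; rfl
  -- distances
  have Ea : ∀ x : G → ℝ, IsProb x → DD x M U R ≤ DD x (pr p1 p2) (fun z => z.1 + z.2) (fun _ => ())
      + (s - ee p1 p2) / 2 := fun x hx =>
    DD_b hx hQ hQ (fun z => z.1 + z.2) (fun z => z.1 + z.2)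
  have EV : ∀ x : G → ℝ, IsProb x → DD x M V R = DD x M U R := fun x hx => by
    rw [← DD_push x sw U R]
    simp only [R1]
    rfl
  have E1 := DD_a1 hx1 hp1 hp2
  have E2 := DD_a2 hx2 hp1 hp2
  have F1 := DD_b1 hx1 hp1 hp2
  have F2 := DD_b2 hx2 hp1 hp2
  have E3 := DD_a1 hx1 hp1 hp1
  have E4 := DD_a1 hx2 hp2 hp2
  have F3 := DD_b1 hx1 hp1 hp1
  have F4 := DD_b1 hx2 hp2 hp2
  have EW1 : DD x1 M W R ≤ DD x1 (pr p1 p1) (fun z => z.1 + z.2) (fun _ => ())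
      + (s - ee p2 p2) / 2 := by
    have := DD_b hx1 (hp1.pr hp1) (hp2.pr hp2) (fun z => z.1 + z.2) (fun z => z.1 + z.2)
    have e : DD x1 M W R = DD x1 (pr (pr p1 p1) (pr p2 p2)) (fun w => w.1.1 + w.1.2) R := by
      rw [← DD_push x1 pi1]; simp only [R2]; rfl
    rw [e, ← s2]
    exact this
  have EW2 : DD x2 M W R ≤ DD x2 (pr p2 p2) (fun z => z.1 + z.2) (fun _ => ())
      + (s - ee p1 p1) / 2 := by
    have := DD_b hx2 (hp2.pr hp2) (hp1.pr hp1) (fun z => z.1 + z.2) (fun z => z.1 + z.2)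
    have e : DD x2 M W R = DD x2 (pr (pr p2 p2) (pr p1 p1)) (fun w => w.1.1 + w.1.2) R := by
      rw [← DD_push x2 pi2, ← DD_shift hx2 hM W R]
      simp only [R3]
      congr 1
      funext w
      have h := h2 (w.1.1 + w.2.1)
      calc R w + W w = (w.1.2 + w.2.2) + ((w.1.1 + w.2.1) + (w.1.1 + w.2.1)) := by
            simp only [R, W]; abel
        _ = _ := by rw [h, add_zero]
    rw [e, ← s3]
    exact this
  -- minimality
  have m1 := hmin_prod hη hx1 hx2 hm hQ hQ (fun z => z.1 + z.2) (fun _ => ())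
    (fun z => z.1 + z.2) (fun _ => ())
  rw [ent_triple_unit (hQ.pr hQ), ent_unit hQ, ent_prod_unit hQ] at m1
  have m2 := hmin_prod hη hx1 hx2 hm hQ hQ (fun z => z.1) (fun z => z.1 + z.2)
    (fun z => z.2) (fun z => z.1 + z.2)
  have j2 : ent (pr (pr p1 p2) (pr p1 p2)) (fun p => (p.1.1 + p.2.2, p.1.1 + p.1.2, p.2.1 + p.2.2))
      = j :=
    ent_eq_of hM (fun q => (q.2.1, q.2.1 + q.2.2 - q.1, q.2.1 + q.2.2))
      (fun q => (q.2.2 - q.2.1, q.1, q.2.2 - q.1))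
      (fun w _ => by simp only [U, V, R, Prod.mk.injEq]; refine ⟨trivial, ?_, trivial⟩; abel)
      (fun w _ => by simp only [U, V, R, Prod.mk.injEq]; refine ⟨?_, trivial, ?_⟩ <;> abel)
  rw [j2, ent_sum_pair1 hp1 hp2, ent_sum_pair2 hp1 hp2] at m2
  have m3 := hmin_prod hη hx1 hx2 hm (hp1.pr hp1) (hp2.pr hp2) (fun z => z.1 + z.2) (fun _ => ())
    (fun z => z.1 + z.2) (fun _ => ())
  rw [ent_triple_unit ((hp1.pr hp1).pr (hp2.pr hp2)), ent_unit (hp1.pr hp1), ent_unit (hp2.pr hp2),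
    ent_prod_unit (hp1.pr hp1), ent_prod_unit (hp2.pr hp2)] at m3
  have m4 := hmin_prod hη hx1 hx2 hm (hp1.pr hp1) (hp2.pr hp2) (fun z => z.1) (fun z => z.1 + z.2)
    (fun z => z.1) (fun z => z.1 + z.2)
  have j4 : ent (pr (pr p1 p1) (pr p2 p2)) (fun p => (p.1.1 + p.2.1, p.1.1 + p.1.2, p.2.1 + p.2.2))
      = j := by
    rw [← pi1.ent, ← jUW]
    exact ent_eq_of hM (fun q => (q.1, q.2.1, q.2.1 + q.2.2)) (fun q => (q.1, q.2.1, q.2.2 - q.2.1))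
      (fun w _ => by simp only [U, W, R, Prod.mk.injEq]; refine ⟨trivial, trivial, ?_⟩; abel)
      (fun w _ => by simp only [U, W, R, Prod.mk.injEq]; refine ⟨trivial, trivial, ?_⟩; abel)
  rw [j4, ent_sum_pair1 hp1 hp1, ent_sum_pair1 hp2 hp2] at m4
  have b1 := hmin_bsg hη hx1 hx2 hm hM U V W R hUV h2
  have b2 := hmin_bsg hη hx1 hx2 hm hM V U W R hVU h2
  have b3 := hmin_bsg hη hx1 hx2 hm hM U W V R hUW h2
  have b4 := hmin_bsg hη hx1 hx2 hm hM W U V R hWU h2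
  have b5 := hmin_bsg hη hx1 hx2 hm hM V W U R hVW h2
  have b6 := hmin_bsg hη hx1 hx2 hm hM W V U R hWV h2
  have q1 := Ea x1 hx1
  have q2 := Ea x2 hx2
  have v1 := EV x1 hx1
  have v2 := EV x2 hx2
  rw [eUR, eVR, eWR] at b1 b2 b3 b4 b5 b6
  rw [jVU] at b2
  rw [jUW] at b3
  rw [jWU] at b4
  rw [jVW] at b5
  rw [jWV] at b6
  have m1' : tau (1/9) x1 x2 p1 p2 ≤ s - ee p1 p2 +
    1/9 * DD x1 (pr p1 p2) (fun z => z.1 + z.2) (fun _ => ()) +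
    1/9 * DD x2 (pr p1 p2) (fun z => z.1 + z.2) (fun _ => ()) := by
    have : ent (pr (pr p1 p2) (pr p1 p2)) (fun p => p.1.1 + p.1.2 + (p.2.1 + p.2.2)) = s := rfl
    rw [this] at m1
    unfold ee
    linarith
  have m3' : tau (1/9) x1 x2 p1 p2 ≤ s - ee p1 p1 / 2 - ee p2 p2 / 2 +
    1/9 * DD x1 (pr p1 p1) (fun z => z.1 + z.2) (fun _ => ()) +
    1/9 * DD x2 (pr p2 p2) (fun z => z.1 + z.2) (fun _ => ()) := by
    have : ent (pr (pr p1 p1) (pr p2 p2)) (fun p => p.1.1 + p.1.2 + (p.2.1 + p.2.2)) = s := s2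
    rw [this] at m3
    unfold ee
    linarith
  change _ ≤ j - ee p1 p2 - ee p1 p2 - (hp p1 + hp p2 - ee p1 p2) / 2
    - (hp p1 + hp p2 - ee p1 p2) / 2 + _ + _ at m2
  change _ ≤ j - ee p1 p1 - ee p2 p2 - (hp p1 + hp p1 - ee p1 p1) / 2
    - (hp p2 + hp p2 - ee p2 p2) / 2 + _ + _ at m4
  clear m1 m3
  clear_value j s
  have hk : dm p1 p2 = ee p1 p2 - hp p1 / 2 - hp p2 / 2 := rfl
  unfold tau at m1' m2 m3' m4 b1 b2 b3 b4 b5 b6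
  linarith

lemma indep_of_ent {μ : Ω → ℝ} (hμ : IsProb μ) (X : Ω → S) (Y : Ω → T)
    (h : ent μ X + ent μ Y ≤ ent μ (fun ω => (X ω, Y ω))) (x : S) (y : T) :
    pmass μ (fun ω => (X ω, Y ω)) (x, y) = pmass μ X x * pmass μ Y y := by
  set P := pmass μ (fun ω => (X ω, Y ω)) with hP
  let f : S × T → ℝ := fun q => pmass μ X q.1 * pmass μ Y q.2 - P q + P q * Real.log (P q)
    - P q * (Real.log (pmass μ X q.1) + Real.log (pmass μ Y q.2))
  have hpos : ∀ q, P q ≠ 0 → 0 < P q ∧ 0 < pmass μ X q.1 ∧ 0 < pmass μ Y q.2 := by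
    intro q hq
    have h0 : 0 < P q := lt_of_le_of_ne (pmass_nonneg hμ _ _) (Ne.symm hq)
    exact ⟨h0, h0.trans_le (pmass_le_comp hμ (fun ω => (X ω, Y ω)) Prod.fst q),
      h0.trans_le (pmass_le_comp hμ (fun ω => (X ω, Y ω)) Prod.snd q)⟩
  have hlog : ∀ q, P q ≠ 0 → f q = P q *
      ((pmass μ X q.1 * pmass μ Y q.2 / P q) - 1
        - Real.log (pmass μ X q.1 * pmass μ Y q.2 / P q)) := by
    intro q hq
    obtain ⟨a, b, c⟩ := hpos q hq
    rw [Real.log_div (by positivity) hq, Real.log_mul b.ne' c.ne']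
    simp only [f]
    field_simp
    ring
  have hf : ∀ q, 0 ≤ f q := by
    intro q
    by_cases hq : P q = 0
    · simp only [f, hq]
      have := mul_nonneg (pmass_nonneg hμ X q.1) (pmass_nonneg hμ Y q.2)
      simpa using this
    · rw [hlog q hq]
      obtain ⟨a, b, c⟩ := hpos q hq
      apply mul_nonneg a.le
      have := Real.log_le_sub_one_of_pos (x := pmass μ X q.1 * pmass μ Y q.2 / P q) (by positivity)
      linarith
  have hsum : ∑ q, f q ≤ 0 := by
    have s1 : ∑ q : S × T, pmass μ X q.1 * pmass μ Y q.2 = 1 := by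
      rw [Fintype.sum_prod_type]
      simp only [← Finset.mul_sum, pmass_sum hμ, mul_one]
    have s2 : ∑ q, P q = 1 := pmass_sum hμ _
    have s3 : ∑ q, P q * Real.log (P q) = - ent μ (fun ω => (X ω, Y ω)) := by
      rw [ent_eq_sum, ← Finset.sum_neg_distrib]
      apply Finset.sum_congr rfl
      intro q _
      rw [Real.negMulLog]; ring
    have s4 : ∑ q, P q * (Real.log (pmass μ X q.1) + Real.log (pmass μ Y q.2)) =
        - ent μ X - ent μ Y := by
      rw [← pushes_law μ (fun ω => (X ω, Y ω))
        (fun q => Real.log (pmass μ X q.1) + Real.log (pmass μ Y q.2)), ent_eq_exp, ent_eq_exp,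
        ← Finset.sum_neg_distrib, ← Finset.sum_sub_distrib]
      apply Finset.sum_congr rfl
      intro ω _
      ring
    simp only [f, Finset.sum_sub_distrib, Finset.sum_add_distrib, s1, s2, s3, s4]
    linarith
  have hz : f (x, y) = 0 := by
    have h0 := le_antisymm hsum (Finset.sum_nonneg (fun q _ => hf q))
    exact (Finset.sum_eq_zero_iff_of_nonneg (fun q _ => hf q)).1 h0 (x, y) (Finset.mem_univ _)
  by_cases hq : P (x, y) = 0
  · simp only [f, hq] at hz
    rw [hq]
    linarith
  · obtain ⟨a, b, c⟩ := hpos _ hq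
    have e := hlog _ hq
    rw [hz] at e
    by_contra hne
    have hr : pmass μ X x * pmass μ Y y / P (x, y) ≠ 1 := by
      intro h1
      rw [div_eq_one_iff_eq hq] at h1
      exact hne h1.symm
    have := Real.log_lt_sub_one_of_pos (x := pmass μ X x * pmass μ Y y / P (x, y))
      (by positivity) hr
    have h3 := mul_pos a (sub_pos.2 this)
    simp only at e
    linarith

lemma ent_le_sum {μ : Ω → ℝ} (hμ : IsProb μ) {ν : Ω' → ℝ} (hν : IsProb ν) (A : Ω → G)
    (B : Ω' → G) : ent μ A ≤ ent (pr μ ν) (fun p => A p.1 + B p.2) := by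
  have h := ent_subadd (hμ.pr hν) (fun p => A p.1 + B p.2) (fun p => B p.2)
  rw [(Pushes.snd ν hμ).ent B] at h
  have e : ent (pr μ ν) (fun p => (A p.1 + B p.2, B p.2)) = ent μ A + ent ν B := by
    rw [← ent_prod hμ hν]
    exact ent_eq_of (hμ.pr hν) (fun q => (q.1 - q.2, q.2)) (fun q => (q.1 + q.2, q.2))
      (by simp) (by simp)
  linarith

lemma hp_le_ee {p q : G → ℝ} (hP : IsProb p) (hQ : IsProb q) : hp p ≤ ee p q :=
  ent_le_sum hP hQ (fun g => g) (fun g => g)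

lemma dm_comm (p q : G → ℝ) : dm p q = dm q p := by
  unfold dm; rw [ee_comm]; ring

lemma dm_nonneg {p q : G → ℝ} (hP : IsProb p) (hQ : IsProb q) : 0 ≤ dm p q := by
  have h1 := hp_le_ee hP hQ
  have h2 := hp_le_ee hQ hP
  rw [ee_comm] at h2
  unfold dm; linarith

lemma dm_triangle {p q r : G → ℝ} (hP : IsProb p) (hQ : IsProb q) (hR : IsProb r) :
    dm p r ≤ dm p q + dm q r := by
  have h := DD_a1 hP hQ hR
  rw [DD_unit' hP (hQ.pr hR)] at h
  have h' := ent_le_sum (hP.pr hR) hQ (fun z => z.1 + z.2) (fun g => g)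
  have e : ent (pr (pr p r) q) (fun z => z.1.1 + z.1.2 + z.2) =
      ent (pr p (pr q r)) (fun z => z.1 + (z.2.1 + z.2.2)) := by
    have : Pushes (pr (pr p r) q) (fun z => (z.1.1, (z.2, z.1.2))) (pr p (pr q r)) :=
      Pushes.of_inv _ (fun z => ((z.1, z.2.2), z.2.1)) (fun _ => rfl) (fun _ => rfl)
        (fun _ => by simp only [pr]; ring)
    rw [← this.ent]
    congr 1
    funext z
    abel
  rw [e] at h'
  unfold dm at *
  change ee p r ≤ _ at h'
  change _ - _ - ee q r / 2 ≤ _ at h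
  linarith

/-- stabilizer of a function -/
def stab (p : G → ℝ) : AddSubgroup G where
  carrier := {h | ∀ z, p (z + h) = p z}
  zero_mem' := by simp
  add_mem' := by
    intro a b ha hb z
    rw [← add_assoc, hb, ha]
  neg_mem' := by
    intro a ha z
    have := ha (z + -a)
    rw [neg_add_cancel_right] at this
    exact this.symm

lemma unif_of {p : G → ℝ} (hP : IsProb p) (H : AddSubgroup G) (x0 : G)
    (h1 : ∀ z, p z ≠ 0 → z - x0 ∈ H) (h2 : ∀ z, z - x0 ∈ H → p z = p x0) (z : G) :
    p z = unifOn (H : Set G) (z - x0) := by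
  have hz : ∀ z, p z = if z - x0 ∈ (H : Set G) then p x0 else 0 := by
    intro z
    split_ifs with h
    · exact h2 z h
    · by_contra h'; exact h (h1 z h')
  have hs : ∑ g, (if g ∈ (H : Set G) then p x0 else 0) = 1 := by
    rw [← hP.2, ← Equiv.sum_comp (Equiv.subRight x0)]
    apply Finset.sum_congr rfl
    intro z _
    rw [hz z]; rfl
  have hc : (Nat.card (H : Set G) : ℝ) * p x0 = 1 := by
    rw [← hs, ← Finset.sum_filter, Finset.sum_const, nsmul_eq_mul, Nat.card_eq_fintype_card,
      Fintype.card_subtype]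
  rw [hz z]
  unfold unifOn
  split_ifs
  · exact eq_inv_of_mul_eq_one_right hc
  · rfl

lemma structure_zero {p q : G → ℝ} (hP : IsProb p) (hQ : IsProb q) (h : dm p q ≤ 0) :
    ∃ (H : AddSubgroup G) (x0 y0 : G), (∀ z, p z = unifOn (H : Set G) (z - x0)) ∧
      (∀ z, q z = unifOn (H : Set G) (z - y0)) := by
  have a1 := hp_le_ee hP hQ
  have a2 := hp_le_ee hQ hP
  rw [ee_comm] at a2
  unfold dm at h
  set c := pmass (pr p q) (fun z => z.1 + z.2) with hc
  have i1 : ∀ z y, q y ≠ 0 → p z = c (z + y) := by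
    intro z y hy
    have := indep_of_ent (hP.pr hQ) (fun z => z.1 + z.2) (fun z => z.2) (by
      have e : ent (pr p q) (fun z => (z.1 + z.2, z.2)) = hp p + hp q := by
        unfold hp
        rw [← ent_prod hP hQ]
        exact ent_eq_of (hP.pr hQ) (fun q => (q.1 - q.2, q.2)) (fun q => (q.1 + q.2, q.2))
          (by simp) (by simp)
      rw [e, (Pushes.snd q hP).ent (fun g => g)]
      change ee p q + hp q ≤ _
      linarith) (z + y) y
    rw [(Pushes.snd q hP).pmass (fun g => g), pmass_id] at this
    have e2 := pmass_inj (pr p q) (fun z => z) (fun w : G × G => (w.1 + w.2, w.2))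
      (fun a b hab => by
        simp only [Prod.mk.injEq] at hab
        obtain ⟨h1, h2⟩ := hab
        rw [h2] at h1
        exact Prod.ext (add_right_cancel h1) h2) (z, y)
    rw [pmass_id] at e2
    simp only at e2
    rw [e2] at this
    exact mul_right_cancel₀ hy this
  have i2 : ∀ z x, p x ≠ 0 → q z = c (z + x) := by
    intro z x hx
    have := indep_of_ent (hP.pr hQ) (fun z => z.1 + z.2) (fun z => z.1) (by
      have e : ent (pr p q) (fun z => (z.1 + z.2, z.1)) = hp p + hp q := by
        unfold hp
        rw [← ent_prod hP hQ]
        exact ent_eq_of (hP.pr hQ) (fun q => (q.2, q.1 - q.2)) (fun q => (q.1 + q.2, q.1))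
          (by simp) (by simp)
      rw [e, (Pushes.fst p hQ).ent (fun g => g)]
      change ee p q + hp p ≤ _
      linarith) (z + x) x
    rw [(Pushes.fst p hQ).pmass (fun g => g), pmass_id] at this
    have e2 := pmass_inj (pr p q) (fun z => z) (fun w : G × G => (w.1 + w.2, w.1))
      (fun a b hab => by
        simp only [Prod.mk.injEq] at hab
        obtain ⟨h1, h2⟩ := hab
        rw [h2] at h1
        exact Prod.ext h2 (add_left_cancel h1)) (x, z)
    rw [pmass_id] at e2
    simp only at e2
    rw [add_comm z x] at this ⊢
    rw [e2] at this
    have this' : p x * q z = _ := this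
    rw [mul_comm (p x)] at this'
    exact mul_right_cancel₀ hx this'
  have ex : ∀ r : G → ℝ, IsProb r → ∃ x, r x ≠ 0 := by
    intro r hr
    by_contra hcon
    push Not at hcon
    have := hr.2
    simp [hcon] at this
  obtain ⟨x0, hx0⟩ := ex p hP
  obtain ⟨y0, hy0⟩ := ex q hQ
  have s1 : ∀ z, p z ≠ 0 → z - x0 ∈ stab q := by
    intro z hz w
    rw [i2 w z hz, i2 _ x0 hx0]
    congr 1; abel
  have s2 : ∀ z, q z ≠ 0 → z - y0 ∈ stab p := by
    intro z hz w
    rw [i1 w z hz, i1 _ y0 hy0]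
    congr 1; abel
  have s3 : stab q ≤ stab p := by
    intro g hg
    have := s2 (y0 + g) (by rw [hg y0]; exact hy0)
    simpa using this
  have s4 : stab p ≤ stab q := by
    intro g hg
    have := s1 (x0 + g) (by rw [hg x0]; exact hx0)
    simpa using this
  refine ⟨stab p, x0, y0, unif_of hP _ _ (fun z hz => s3 (s1 z hz)) ?_,
    unif_of hQ _ _ s2 ?_⟩
  · intro z hz
    have := hz x0
    rwa [add_sub_cancel] at this
  · intro z hz
    have := s4 hz y0
    rwa [add_sub_cancel] at this

lemma dm_unif {x p u : G → ℝ} (hx : IsProb x) (x0 : G) (h : ∀ z, p z = u (z - x0))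
    (hu : IsProb u) : dm x p = dm x u := by
  have hpush : Pushes u (fun g => g + x0) p :=
    Pushes.of_inv _ (fun g => g - x0) (by simp) (by simp) (by simp [h])
  unfold dm ee hp
  rw [← hpush.ent (fun g => g), ← ((Pushes.id x).prod hpush).ent (fun z => z.1 + z.2),
    ent_eq_of hu (X := fun g => g + x0) (Y := fun g => g) (fun g => g - x0) (fun g => g + x0)
      (by simp) (by simp),
    ent_eq_of (hx.pr hu) (X := fun z => z.1 + (z.2 + x0)) (Y := fun z => z.1 + z.2)
      (fun g => g - x0) (fun g => g + x0)
      (fun _ _ => by abel) (fun _ _ => by abel)]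

lemma isProb_unif (H : AddSubgroup G) : IsProb (unifOn (H : Set G)) := by
  refine ⟨fun g => ?_, ?_⟩
  · unfold unifOn; split_ifs <;> positivity
  · unfold unifOn
    rw [← Finset.sum_filter, Finset.sum_const, nsmul_eq_mul, Nat.card_eq_fintype_card,
      Fintype.card_subtype]
    apply mul_inv_cancel₀
    have : 0 < #{x : G | x ∈ (H : Set G)} := Finset.card_pos.2 ⟨0, by simp⟩
    positivity

lemma cont_tau (η : ℝ) (x1 x2 : G → ℝ) :
    Continuous (fun pq : (G → ℝ) × (G → ℝ) => tau η x1 x2 pq.1 pq.2) := by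
  have hc := Real.continuous_negMulLog
  have c1 : ∀ (f g : (G → ℝ) × (G → ℝ) → (G → ℝ)), Continuous f → Continuous g →
      Continuous (fun pq => ee (f pq) (g pq)) := by
    intro f g hf hg
    simp only [ee, ent_eq_sum, pmass_eq, pr]
    fun_prop
  have c2 : ∀ (f : (G → ℝ) × (G → ℝ) → (G → ℝ)), Continuous f →
      Continuous (fun pq => hp (f pq)) := by
    intro f hf
    simp only [hp, ent_eq_sum, pmass_eq]
    fun_prop
  have c3 : ∀ (f g : (G → ℝ) × (G → ℝ) → (G → ℝ)), Continuous f → Continuous g →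
      Continuous (fun pq => dm (f pq) (g pq)) := by
    intro f g hf hg
    unfold dm
    exact ((c1 f g hf hg).sub ((c2 f hf).div_const _)).sub ((c2 g hg).div_const _)
  unfold tau
  exact ((c3 _ _ continuous_fst continuous_snd).add
    ((c3 _ _ continuous_const continuous_fst).const_mul η)).add
    ((c3 _ _ continuous_const continuous_snd).const_mul η)

lemma exists_min (η : ℝ) {x1 x2 : G → ℝ} (hx1 : IsProb x1) (hx2 : IsProb x2) :
    ∃ p1 p2 : G → ℝ, IsProb p1 ∧ IsProb p2 ∧ TauMin η x1 x2 (tau η x1 x2 p1 p2) := by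
  have hK : IsCompact (stdSimplex ℝ G ×ˢ stdSimplex ℝ G) :=
    (isCompact_stdSimplex ℝ G).prod (isCompact_stdSimplex ℝ G)
  obtain ⟨⟨p1, p2⟩, h, hmin⟩ := hK.exists_isMinOn ⟨(x1, x2), ⟨hx1, hx2⟩⟩
    (cont_tau η x1 x2).continuousOn
  exact ⟨p1, p2, h.1, h.2, fun p q hp hq => hmin (a := (p, q)) ⟨hp, hq⟩⟩

lemma pfr_main (h2 : ∀ g : G, g + g = 0) {x1 x2 : G → ℝ} (hx1 : IsProb x1) (hx2 : IsProb x2) :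
    ∃ H : AddSubgroup G, dm x1 (unifOn (H : Set G)) + dm x2 (unifOn (H : Set G)) ≤ 11 * dm x1 x2
      ∧ dm x1 (unifOn (H : Set G)) ≤ 6 * dm x1 x2
      ∧ dm x2 (unifOn (H : Set G)) ≤ 6 * dm x1 x2 := by
  obtain ⟨p1, p2, hp1, hp2, hm⟩ := exists_min (1/9) hx1 hx2
  have hk := k_le_zero h2 hx1 hx2 hp1 hp2 hm
  obtain ⟨H, x0, y0, e1, e2⟩ := structure_zero hp1 hp2 hk
  have hu := isProb_unif H
  have d1 := dm_unif hx1 x0 e1 hu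
  have d2 := dm_unif hx2 y0 e2 hu
  have d0 := dm_nonneg hp1 hp2
  have ht := hm x2 x1 hx2 hx1
  unfold tau at ht
  rw [dm_comm x2 x1, d1, d2] at ht
  have t1 := dm_triangle hx1 hx2 hu
  have t2 := dm_triangle hx2 hx1 hu
  rw [dm_comm x2 x1] at t2
  refine ⟨H, ?_, ?_, ?_⟩ <;> linarith

lemma rdist_eq (h2 : ∀ g : G, g + g = 0) (μ : Ω → ℝ) (ν : Ω' → ℝ) (X : Ω → G) (Y : Ω' → G) :
    rdist μ X ν Y = dm (pmass μ X) (pmass ν Y) := by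
  have hs : ∀ a b : G, a - b = a + b := fun a b => by
    rw [sub_eq_add_neg, neg_eq_of_add_eq_zero_left (h2 b)]
  unfold rdist dm ee hp
  simp only [hs]
  rw [← (pushes_law μ X).ent (fun g => g), ← (pushes_law ν Y).ent (fun g => g),
    ← ((pushes_law μ X).prod (pushes_law ν Y)).ent (fun z => z.1 + z.2)]
  rfl
end PFR

/-- **Entropic polynomial Freiman–Ruzsa, with constant 11.** For `G = F_2^n` and
finitely supported `G`-valued random variables `X₁⁰, X₂⁰`, there is a subgroup `H ≤ G`
with `d[X₁⁰; U_H] + d[X₂⁰; U_H] ≤ 11 d[X₁⁰; X₂⁰]`, and moreover each of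
`d[X₁⁰; U_H], d[X₂⁰; U_H]` is at most `6 d[X₁⁰; X₂⁰]`. -/
theorem entropic_pfr {n : ℕ} {Ω₁ Ω₂ : Type} [Fintype Ω₁] [Fintype Ω₂]
    (μ₁ : Ω₁ → ℝ) (μ₂ : Ω₂ → ℝ) (hμ₁ : IsProb μ₁) (hμ₂ : IsProb μ₂)
    (X₁ : Ω₁ → (Fin n → ZMod 2)) (X₂ : Ω₂ → (Fin n → ZMod 2)) :
    ∃ H : AddSubgroup (Fin n → ZMod 2),
      rdist μ₁ X₁ (unifOn (H : Set (Fin n → ZMod 2))) (fun g => g)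
          + rdist μ₂ X₂ (unifOn (H : Set (Fin n → ZMod 2))) (fun g => g)
        ≤ 11 * rdist μ₁ X₁ μ₂ X₂
      ∧ rdist μ₁ X₁ (unifOn (H : Set (Fin n → ZMod 2))) (fun g => g)
          ≤ 6 * rdist μ₁ X₁ μ₂ X₂
      ∧ rdist μ₂ X₂ (unifOn (H : Set (Fin n → ZMod 2))) (fun g => g)
          ≤ 6 * rdist μ₁ X₁ μ₂ X₂ := by
  have h2 : ∀ g : Fin n → ZMod 2, g + g = 0 := fun g => by
    funext i
    exact CharTwo.add_self_eq_zero (g i)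
  obtain ⟨H, h⟩ := pfr_main h2 (isProb_law hμ₁ X₁) (isProb_law hμ₂ X₂)
  refine ⟨H, ?_⟩
  simp only [rdist_eq h2, pmass_id]
  exact h

end
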